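/- Let U and Y be complex Hilbert spaces and let g : G → B(U,Y). Then g is analytic on G with ‖g(s,p)‖ ≤ 1 for all (s,p) ∈ G if and only if there exist a complex Hilbert space H and bounded operators α₁, α₂ ∈ B(H), β ∈ B(U,H), γ ∈ B(H,Y), δ ∈ B(U,Y) such that the block operator M̃ = [[α₁, 0, β], [0, α₂, 0], [γ, 0, δ]] : H ⊕ H ⊕ U → H ⊕ H ⊕ Y is a contraction, and for every (s,p) ∈ G the operator I − (s/2)(α₁ + α₂) + p·α₁α₂ on H is invertible and g(s,p) = δ + (1/2)·γ·(sI − 2p·α₂)·(I − (s/2)(α₁ + α₂) + p·α₁α₂)⁻¹·β. -/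

import Mathlib

noncomputable section

open ContinuousLinearMap

/-- The open bidisk `𝔻² = {(z,ζ) : |z| < 1, |ζ| < 1}`. -/
def bidisk : Set (ℂ × ℂ) := {w : ℂ × ℂ | ‖w.1‖ < 1 ∧ ‖w.2‖ < 1}

/-- The symmetrized bidisk `𝔾`, the image of the bidisk under `(z,ζ) ↦ (z+ζ, zζ)`. -/
def symBidisk : Set (ℂ × ℂ) := (fun w : ℂ × ℂ => (w.1 + w.2, w.1 * w.2)) '' bidisk

variable {H U Y : Type*}
  [NormedAddCommGroup H] [NormedSpace ℂ H]
  [NormedAddCommGroup U] [NormedSpace ℂ U]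
  [NormedAddCommGroup Y] [NormedSpace ℂ Y]

/-- The colligation `M̃ = [[α₁,0,β],[0,α₂,0],[γ,0,δ]] : H ⊕ H ⊕ U → H ⊕ H ⊕ Y` is a
contraction (with respect to the Hilbert space direct sum norms). -/
def GColligationContractive (α₁ α₂ : H →L[ℂ] H) (β : U →L[ℂ] H) (γ : H →L[ℂ] Y)
    (δ : U →L[ℂ] Y) : Prop :=
  ∀ (h₁ h₂ : H) (u : U),
    ‖α₁ h₁ + β u‖ ^ 2 + ‖α₂ h₂‖ ^ 2 + ‖γ h₁ + δ u‖ ^ 2 ≤ ‖h₁‖ ^ 2 + ‖h₂‖ ^ 2 + ‖u‖ ^ 2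

/-- The transfer function `δ + ½ γ (sI - 2p α₂)(I - (s/2)(α₁+α₂) + p α₁α₂)⁻¹ β` associated
with a colligation on the symmetrized bidisk. -/
def gTransfer (α₁ α₂ : H →L[ℂ] H) (β : U →L[ℂ] H) (γ : H →L[ℂ] Y) (δ : U →L[ℂ] Y)
    (s p : ℂ) : U →L[ℂ] Y :=
  δ + (2 : ℂ)⁻¹ •
    (γ ∘L ((s • (1 : H →L[ℂ] H) - (2 * p) • α₂) *
        Ring.inverse ((1 : H →L[ℂ] H) - (s / 2) • (α₁ + α₂) + p • (α₁ * α₂))) ∘L β)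

universe u v


namespace SymBidiskAux

lemma gram_contraction {ι H H' : Type*} [NormedAddCommGroup H] [InnerProductSpace ℂ H]
    [CompleteSpace H] [NormedAddCommGroup H'] [InnerProductSpace ℂ H'] [CompleteSpace H']
    (x : ι → H) (y : ι → H')
    (h : ∀ i j, inner ℂ (x i) (x j) = inner ℂ (y i) (y j)) :
    ∃ T : H →L[ℂ] H', (∀ a, ‖T a‖ ≤ ‖a‖) ∧ (∀ i, T (x i) = y i) ∧
      ∀ a ∈ (Submodule.span ℂ (Set.range x)).topologicalClosure, ‖T a‖ = ‖a‖ := by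
  set M := (Submodule.span ℂ (Set.range x)).topologicalClosure with hM
  have hMc : CompleteSpace M :=
    (Submodule.isClosed_topologicalClosure _).completeSpace_coe
  let A : (ι →₀ ℂ) →ₗ[ℂ] H := Finsupp.linearCombination ℂ x
  let B : (ι →₀ ℂ) →ₗ[ℂ] H' := Finsupp.linearCombination ℂ y
  have hAB : ∀ c, ‖A c‖ = ‖B c‖ := by
    intro c
    have : inner ℂ (A c) (A c) = inner ℂ (B c) (B c) := by
      simp only [A, B, Finsupp.linearCombination_apply, Finsupp.sum_inner, Finsupp.inner_sum,
        inner_smul_left, inner_smul_right, h]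
    rw [inner_self_eq_norm_sq_to_K, inner_self_eq_norm_sq_to_K] at this
    have h2 : ‖A c‖ ^ 2 = ‖B c‖ ^ 2 := by exact_mod_cast this
    exact (sq_eq_sq₀ (norm_nonneg _) (norm_nonneg _)).1 h2
  have hAmem : ∀ c, A c ∈ M := by
    intro c
    apply Submodule.le_topologicalClosure
    rw [← Finsupp.range_linearCombination]
    exact ⟨c, rfl⟩
  let A' : (ι →₀ ℂ) →ₗ[ℂ] M := A.codRestrict M hAmem
  have hdense : DenseRange A' := by
    intro m
    rw [Metric.mem_closure_iff]
    intro ε hε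
    have hm : (m : H) ∈ closure ((Submodule.span ℂ (Set.range x) : Submodule ℂ H) : Set H) := m.2
    rw [Metric.mem_closure_iff] at hm
    obtain ⟨b, hb, hd⟩ := hm ε hε
    rw [SetLike.mem_coe, ← Finsupp.range_linearCombination] at hb
    obtain ⟨c, rfl⟩ := hb
    exact ⟨A' c, ⟨c, rfl⟩, hd⟩
  have hnorm : ∀ c, ‖B c‖ ≤ 1 * ‖A' c‖ := by
    intro c; rw [← hAB, one_mul]; exact le_rfl
  let T' : M →L[ℂ] H' := B.extendOfNorm A'
  have hT' : ∀ c, T' (A' c) = B c := fun c => LinearMap.extendOfNorm_eq hdense ⟨1, hnorm⟩ c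
  have hT'n : ∀ m : M, ‖T' m‖ = ‖m‖ := by
    intro m
    refine hdense.induction_on m (isClosed_eq (by fun_prop) (by fun_prop)) ?_
    intro c
    rw [hT', ← hAB]; rfl
  refine ⟨T' ∘L M.orthogonalProjectionOnto, ?_, ?_, ?_⟩
  · intro a
    rw [comp_apply, hT'n]
    exact Submodule.norm_orthogonalProjectionOnto_apply_le M a
  · intro i
    have h1 : x i = A' (Finsupp.single i 1) := by simp [A', A]
    rw [comp_apply, h1, Submodule.orthogonalProjectionOnto_mem_subspace_eq_self, hT']
    simp [B]
  · intro a ha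
    rw [comp_apply, hT'n]
    have := Submodule.orthogonalProjectionOnto_mem_subspace_eq_self (K := M) ⟨a, ha⟩
    simp only at this
    rw [this]; rfl

end SymBidiskAux

namespace SymBidiskAux
lemma magic_ineq (z ζ : ℂ) (hz : ‖z‖ < 1) (hζ : ‖ζ‖ < 1) :
    ‖(z + ζ) - (starRingEnd ℂ) (z + ζ) * (z * ζ)‖
      ≤ 1 - ‖z * ζ‖ ^ 2 - (1 - ‖z‖) * (1 - ‖ζ‖) * (1 - ‖z‖ * ‖ζ‖) := by
  have : (z + ζ) - (starRingEnd ℂ) (z + ζ) * (z * ζ)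
      = (1 - ‖ζ‖ ^ 2 : ℝ) * z + (1 - ‖z‖ ^ 2 : ℝ) * ζ := by
    have h1 := Complex.mul_conj' z
    have h2 := Complex.mul_conj' ζ
    push_cast
    rw [← h1, ← h2, map_add]; ring
  rw [this]
  have a1 := norm_nonneg z
  have a2 := norm_nonneg ζ
  refine (norm_add_le _ _).trans ?_
  rw [norm_mul, norm_mul, norm_mul, Complex.norm_real, Complex.norm_real, Real.norm_eq_abs,
    Real.norm_eq_abs, abs_of_nonneg (by nlinarith), abs_of_nonneg (by nlinarith)]
  nlinarith

lemma phi_ineq {H : Type*} [NormedAddCommGroup H] [InnerProductSpace ℂ H]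
    (z ζ : ℂ) (hz : ‖z‖ < 1) (hζ : ‖ζ‖ < 1) :
    ∃ c : ℝ, 0 < c ∧ ∀ h a : H, ‖a‖ ≤ ‖h‖ →
      ‖((z + ζ) / 2) • h - (z * ζ) • a‖ ^ 2 + c * ‖h‖ ^ 2 ≤ ‖h - ((z + ζ) / 2) • a‖ ^ 2 := by
  set σ : ℂ := (z + ζ) / 2 with hσ
  set p : ℂ := z * ζ with hp
  have a1 := norm_nonneg z
  have a2 := norm_nonneg ζ
  set c0 : ℝ := (1 - ‖z‖) * (1 - ‖ζ‖) * (1 - ‖z‖ * ‖ζ‖) with hc0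
  have hc0pos : 0 < c0 := by
    apply mul_pos (mul_pos (by linarith) (by linarith)); nlinarith
  have hB : 2 * ‖σ - (starRingEnd ℂ) σ * p‖ ≤ 1 - ‖p‖ ^ 2 - c0 := by
    have := magic_ineq z ζ hz hζ
    have e : (z + ζ) - (starRingEnd ℂ) (z + ζ) * (z * ζ) = 2 * (σ - (starRingEnd ℂ) σ * p) := by
      simp only [hσ, hp, map_div₀, Complex.conj_ofNat]; ring
    rw [e, norm_mul, ← hp, ← hc0, Complex.norm_ofNat] at this
    exact this
  have hσn : ‖σ‖ < 1 := by
    have h1 : ‖σ‖ = ‖z + ζ‖ / 2 := by simp [hσ]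
    have := norm_add_le z ζ
    rw [h1]; linarith
  have hσ2 : 2 * ‖σ‖ ^ 2 ≤ ‖z‖ ^ 2 + ‖ζ‖ ^ 2 := by
    have h1 : ‖σ‖ = ‖z + ζ‖ / 2 := by simp [hσ]
    have h2 := norm_add_le z ζ
    have h3 := norm_nonneg (z + ζ)
    rw [h1]; nlinarith [sq_nonneg (‖z‖ - ‖ζ‖)]
  have hpn : ‖p‖ = ‖z‖ * ‖ζ‖ := by simp [hp]
  have hA : 0 < 1 - ‖σ‖ ^ 2 := by nlinarith [norm_nonneg σ]
  have hAC : 0 < (1 - ‖σ‖ ^ 2) - (‖σ‖ ^ 2 - ‖p‖ ^ 2) := by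
    have : 0 < (1 - ‖z‖ ^ 2) * (1 - ‖ζ‖ ^ 2) := by
      apply mul_pos <;> nlinarith
    rw [hpn]; nlinarith
  set m : ℝ := min (1 - ‖σ‖ ^ 2) ((1 - ‖σ‖ ^ 2) - (‖σ‖ ^ 2 - ‖p‖ ^ 2)) with hm
  have hmpos : 0 < m := lt_min hA hAC
  refine ⟨min m c0, lt_min hmpos hc0pos, ?_⟩
  intro h a hah
  set X := ‖h‖
  set Y := ‖a‖
  have hX : 0 ≤ X := norm_nonneg h
  have hY : 0 ≤ Y := norm_nonneg a
  have e1 : ‖h - σ • a‖ ^ 2 - ‖σ • h - p • a‖ ^ 2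
      = (1 - ‖σ‖ ^ 2) * X ^ 2 + (‖σ‖ ^ 2 - ‖p‖ ^ 2) * Y ^ 2
        - 2 * ((σ - (starRingEnd ℂ) σ * p) * inner ℂ h a).re := by
    rw [@norm_sub_sq ℂ, @norm_sub_sq ℂ]
    simp only [inner_smul_left, inner_smul_right, norm_smul, sub_mul, Complex.sub_re,
      RCLike.re_eq_complex_re]
    rw [show p * ((starRingEnd ℂ) σ * inner ℂ h a) = (starRingEnd ℂ) σ * p * inner ℂ h a by ring]
    ring
  have e2 : ((σ - (starRingEnd ℂ) σ * p) * inner ℂ h a).re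
      ≤ ‖σ - (starRingEnd ℂ) σ * p‖ * (X * Y) := by
    refine (Complex.re_le_norm _).trans ?_
    rw [norm_mul]
    exact mul_le_mul_of_nonneg_left (norm_inner_le_norm h a) (norm_nonneg _)
  have hXY : 0 ≤ X * Y := mul_nonneg hX hY
  have e3 : 2 * (‖σ - (starRingEnd ℂ) σ * p‖ * (X * Y)) ≤ (1 - ‖p‖ ^ 2 - c0) * (X * Y) := by
    nlinarith
  have e4 : m * X ≤ (1 - ‖σ‖ ^ 2) * X - (‖σ‖ ^ 2 - ‖p‖ ^ 2) * Y := by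
    rcases le_total 0 (‖σ‖ ^ 2 - ‖p‖ ^ 2) with hC | hC
    · have : m * X ≤ ((1 - ‖σ‖ ^ 2) - (‖σ‖ ^ 2 - ‖p‖ ^ 2)) * X :=
        mul_le_mul_of_nonneg_right (min_le_right _ _) hX
      have h2 := mul_le_mul_of_nonneg_left hah hC
      linarith
    · have : m * X ≤ (1 - ‖σ‖ ^ 2) * X :=
        mul_le_mul_of_nonneg_right (min_le_left _ _) hX
      have h2 := mul_nonneg (neg_nonneg.2 hC) hY
      linarith
  have e5 : (X - Y) * (m * X) ≤ (X - Y) * ((1 - ‖σ‖ ^ 2) * X - (‖σ‖ ^ 2 - ‖p‖ ^ 2) * Y) :=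
    mul_le_mul_of_nonneg_left e4 (by linarith)
  have e6 : min m c0 * ((X - Y) * X) ≤ m * ((X - Y) * X) :=
    mul_le_mul_of_nonneg_right (min_le_left _ _) (mul_nonneg (by linarith) hX)
  have e7 : min m c0 * (X * Y) ≤ c0 * (X * Y) :=
    mul_le_mul_of_nonneg_right (min_le_right _ _) hXY
  nlinarith

lemma isUnit_R {H : Type*} [NormedAddCommGroup H] [InnerProductSpace ℂ H] [CompleteSpace H]
    (α₁ α₂ : H →L[ℂ] H) (h1 : ∀ h, ‖α₁ h‖ ≤ ‖h‖) (h2 : ∀ h, ‖α₂ h‖ ≤ ‖h‖)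
    (z ζ : ℂ) (hz : ‖z‖ < 1) (hζ : ‖ζ‖ < 1) :
    IsUnit ((1 : H →L[ℂ] H) - ((z + ζ) / 2) • (α₁ + α₂) + (z * ζ) • (α₁ * α₂)) := by
  obtain ⟨c, hc, hineq⟩ := phi_ineq (H := H) z ζ hz hζ
  set σ : ℂ := (z + ζ) / 2 with hσ
  set p : ℂ := z * ζ with hp
  have hα₁ : ‖α₁‖ ≤ 1 := opNorm_le_bound _ zero_le_one (by simpa using h1)
  have hα₂ : ‖α₂‖ ≤ 1 := opNorm_le_bound _ zero_le_one (by simpa using h2)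
  have hσn : ‖σ‖ < 1 := by
    have h1 : ‖σ‖ = ‖z + ζ‖ / 2 := by simp [hσ]
    have := norm_add_le z ζ
    rw [h1]; linarith
  have hu : IsUnit (1 - σ • α₂) := by
    apply isUnit_one_sub_of_norm_lt_one
    rw [norm_smul]
    nlinarith [norm_nonneg σ, norm_nonneg α₂]
  obtain ⟨u, hu'⟩ := hu
  let Φ : H →L[ℂ] H := (σ • 1 - p • α₂) * (↑u⁻¹ : H →L[ℂ] H)
  have hΦ : ‖α₁ * Φ‖ < 1 := by
    have hb : ∀ h, ‖Φ h‖ ^ 2 ≤ (1 - c / 4) * ‖h‖ ^ 2 := by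
      intro h
      set k := (↑u⁻¹ : H →L[ℂ] H) h with hk
      have hh : h = k - σ • α₂ k := by
        have : ((u : H →L[ℂ] H) * (↑u⁻¹ : H →L[ℂ] H)) h = h := by simp
        rw [← this, mul_apply_eq_comp, hu']; simp [hk]
      have e1 : Φ h = σ • k - p • α₂ k := by simp [Φ, hk]
      have e2 := hineq k (α₂ k) (h2 k)
      rw [e1]
      have e3 : ‖h‖ ≤ 2 * ‖k‖ := by
        rw [hh]
        refine (norm_sub_le _ _).trans ?_
        rw [norm_smul]
        have := h2 k
        nlinarith [norm_nonneg σ, norm_nonneg k, norm_nonneg (α₂ k)]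
      rw [← hh] at e2
      have e4 : ‖h‖ ^ 2 ≤ 4 * ‖k‖ ^ 2 := by nlinarith [norm_nonneg h, norm_nonneg k]
      nlinarith
    have hq : Real.sqrt (1 - c / 4) < 1 := by
      rw [Real.sqrt_lt' one_pos]; linarith
    have hn : ‖Φ‖ ≤ Real.sqrt (1 - c / 4) := by
      apply opNorm_le_bound _ (Real.sqrt_nonneg _)
      intro h
      have := Real.sqrt_le_sqrt (hb h)
      rwa [Real.sqrt_sq (norm_nonneg _), Real.sqrt_mul' _ (sq_nonneg _),
        Real.sqrt_sq (norm_nonneg _)] at this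
    have := norm_mul_le α₁ Φ
    nlinarith [norm_nonneg Φ, norm_nonneg α₁]
  have hv := isUnit_one_sub_of_norm_lt_one hΦ
  have key : (1 : H →L[ℂ] H) - σ • (α₁ + α₂) + p • (α₁ * α₂) = (1 - α₁ * Φ) * (u : H →L[ℂ] H) := by
    rw [sub_mul, mul_assoc]
    have : Φ * (u : H →L[ℂ] H) = σ • 1 - p • α₂ := by simp [Φ, mul_assoc]
    rw [this, hu']
    simp only [mul_sub, mul_smul_comm, mul_one, one_mul, smul_add]
    abel
  rw [key]
  exact hv.mul u.isUnit


lemma gTransfer_identity {H U Y : Type*} [NormedAddCommGroup H] [InnerProductSpace ℂ H]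
    [NormedAddCommGroup U] [NormedSpace ℂ U] [NormedAddCommGroup Y] [NormedSpace ℂ Y]
    (α₁ α₂ : H →L[ℂ] H) (β : U →L[ℂ] H) (γ : H →L[ℂ] Y) (δ : U →L[ℂ] Y) (s p : ℂ)
    (hR : IsUnit ((1 : H →L[ℂ] H) - (s / 2) • (α₁ + α₂) + p • (α₁ * α₂))) (u : U) (x : H)
    (hx : x - (s / 2) • α₂ x = α₁ ((s / 2) • x - p • α₂ x) + β u) :
    gTransfer α₁ α₂ β γ δ s p u = γ ((s / 2) • x - p • α₂ x) + δ u := by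
  obtain ⟨r, hr⟩ := hR
  have h1 : (r : H →L[ℂ] H) x = β u := by
    rw [hr]
    have : β u = x - (s / 2) • α₂ x - α₁ ((s / 2) • x - p • α₂ x) := by rw [hx]; abel
    rw [this]
    simp only [add_apply, sub_apply, smul_apply, mul_apply_eq_comp, one_apply_eq_self, map_sub, map_smul, smul_add]
    abel
  have h2 : (↑r⁻¹ : H →L[ℂ] H) (β u) = x := by
    rw [← h1, ← mul_apply_eq_comp]; simp
  have h3 : (2 : ℂ)⁻¹ • (s • x - (2 * p) • α₂ x) = (s / 2) • x - p • α₂ x := by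
    rw [smul_sub, smul_smul, smul_smul]; congr 2 <;> ring
  rw [gTransfer, ← hr, Ring.inverse_unit]
  simp only [add_apply, sub_apply, smul_apply, mul_apply_eq_comp, one_apply_eq_self, comp_apply, h2]
  rw [← map_smul, h3, add_comm]

lemma backward {U : Type*} {Y : Type*}
    [NormedAddCommGroup U] [InnerProductSpace ℂ U] [CompleteSpace U]
    [NormedAddCommGroup Y] [InnerProductSpace ℂ Y] [CompleteSpace Y]
    (g : ℂ × ℂ → (U →L[ℂ] Y)) {H : Type*} [NormedAddCommGroup H] [InnerProductSpace ℂ H]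
        [CompleteSpace H] (α₁ α₂ : H →L[ℂ] H) (β : U →L[ℂ] H) (γ : H →L[ℂ] Y)
        (δ : U →L[ℂ] Y)
        (hcon : GColligationContractive α₁ α₂ β γ δ)
        (hg : ∀ w ∈ symBidisk,
            IsUnit ((1 : H →L[ℂ] H) - (w.1 / 2) • (α₁ + α₂) + w.2 • (α₁ * α₂)) ∧
              g w = gTransfer α₁ α₂ β γ δ w.1 w.2) (hopen : IsOpen symBidisk) :
    (AnalyticOnNhd ℂ g symBidisk ∧ ∀ w ∈ symBidisk, ‖g w‖ ≤ 1) := by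
  constructor
  · intro w hw
    have hev : (fun w : ℂ × ℂ => gTransfer α₁ α₂ β γ δ w.1 w.2) =ᶠ[nhds w] g := by
      filter_upwards [hopen.mem_nhds hw] with w' hw'
      exact ((hg w' hw').2).symm
    refine AnalyticAt.congr ?_ hev
    unfold gTransfer
    have hf : AnalyticAt ℂ (fun w : ℂ × ℂ => w.1) w := analyticAt_fst
    have hs : AnalyticAt ℂ (fun w : ℂ × ℂ => w.2) w := analyticAt_snd
    have hinv : AnalyticAt ℂ (fun w : ℂ × ℂ =>
        Ring.inverse ((1 : H →L[ℂ] H) - (w.1 / 2) • (α₁ + α₂) + w.2 • (α₁ * α₂))) w := by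
      obtain ⟨r, hr⟩ := (hg w hw).1
      refine AnalyticAt.fun_comp (g := Ring.inverse) ?_ ?_
      · rw [← hr]; exact analyticAt_inverse r
      · exact (analyticAt_const.sub ((hf.fun_div analyticAt_const two_ne_zero).fun_smul analyticAt_const)).add (hs.fun_smul analyticAt_const)
    have h2 : AnalyticAt ℂ (fun w : ℂ × ℂ =>
        (w.1 • (1 : H →L[ℂ] H) - (2 * w.2) • α₂)) w :=
      (hf.fun_smul analyticAt_const).sub ((analyticAt_const.fun_mul hs).fun_smul analyticAt_const)
    have h3 := h2.mul hinv
    let Ψ : (H →L[ℂ] H) →L[ℂ] (U →L[ℂ] Y) :=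
      (compL ℂ U H Y γ) ∘L ((compL ℂ U H H).flip β)
    have h4 : AnalyticAt ℂ (fun w : ℂ × ℂ => δ + (2 : ℂ)⁻¹ • Ψ ((w.1 • (1 : H →L[ℂ] H) - (2 * w.2) • α₂) *
        Ring.inverse ((1 : H →L[ℂ] H) - (w.1 / 2) • (α₁ + α₂) + w.2 • (α₁ * α₂)))) w := by
      have := (Ψ.analyticAt _).fun_comp h3
      exact analyticAt_const.add (analyticAt_const.fun_smul this)
    exact h4
  · rintro w hw
    obtain ⟨hR, hgw⟩ := hg w hw
    obtain ⟨⟨z, ζ⟩, ⟨hz, hζ⟩, rfl⟩ := hw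
    simp only at hR hgw hz hζ
    obtain ⟨c, hc, hineq⟩ := phi_ineq (H := H) z ζ hz hζ
    have h2 : ∀ h, ‖α₂ h‖ ≤ ‖h‖ := by
      intro h
      have := hcon 0 h 0
      simp at this
      exact le_of_sq_le_sq this (norm_nonneg _)
    refine opNorm_le_bound _ zero_le_one fun u => ?_
    obtain ⟨r, hr⟩ := id hR
    set x := (↑r⁻¹ : H →L[ℂ] H) (β u) with hx
    have h1 : (r : H →L[ℂ] H) x = β u := by rw [hx, ← mul_apply_eq_comp]; simp
    have hx' : x - ((z + ζ) / 2) • α₂ x = α₁ (((z + ζ) / 2) • x - (z * ζ) • α₂ x) + β u := by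
      rw [← h1, hr]
      simp only [add_apply, sub_apply, smul_apply, mul_apply_eq_comp, one_apply_eq_self, map_sub, map_smul, smul_add]
      abel
    rw [hgw, gTransfer_identity α₁ α₂ β γ δ _ _ hR u x hx']
    have e1 := hcon (((z + ζ) / 2) • x - (z * ζ) • α₂ x) 0 u
    rw [← hx'] at e1
    have e2 := hineq x (α₂ x) (h2 x)
    simp only [map_zero, norm_zero] at e1
    rw [one_mul]
    refine le_of_sq_le_sq ?_ (norm_nonneg _)
    nlinarith [sq_nonneg ‖x‖]


lemma symBidisk_eq : symBidisk =
    {x : ℂ × ℂ | ∀ w ∈ Metric.closedBall (0 : ℂ) 1, 1 - x.1 * w + x.2 * w ^ 2 ≠ 0} := by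
  ext ⟨s, p⟩
  constructor
  · rintro ⟨⟨z, ζ⟩, ⟨hz, hζ⟩, h⟩
    simp only [Prod.mk.injEq] at h hz hζ
    obtain ⟨rfl, rfl⟩ := h
    intro w hw
    rw [mem_closedBall_zero_iff] at hw
    have key : ∀ a : ℂ, ‖a‖ < 1 → 1 - a * w ≠ 0 := by
      intro a ha h0
      have h1 : a * w = 1 := (sub_eq_zero.1 h0).symm
      have h2 : ‖a‖ * ‖w‖ = 1 := by rw [← norm_mul, h1, norm_one]
      nlinarith [norm_nonneg a, norm_nonneg w]
    have := mul_ne_zero (key z hz) (key ζ hζ)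
    convert this using 1
    simp only; ring
  · intro h
    simp only [Set.mem_ofPred_eq] at h
    have key : ∀ a : ℂ, a ^ 2 - s * a + p = 0 → ‖a‖ < 1 := by
      intro a ha
      by_contra hn
      push Not at hn
      have ha0 : a ≠ 0 := by
        rintro rfl; simp at hn; linarith
      refine h a⁻¹ ?_ ?_
      · rw [mem_closedBall_zero_iff, norm_inv]; exact inv_le_one_of_one_le₀ hn
      · field_simp
        linear_combination ha
    obtain ⟨q, hq⟩ := IsAlgClosed.exists_pow_nat_eq (s ^ 2 - 4 * p) (n := 2) (by norm_num)
    refine ⟨((s + q) / 2, (s - q) / 2), ⟨key _ ?_, key _ ?_⟩, ?_⟩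
    · simp only; linear_combination (1 / 4) * hq
    · simp only; linear_combination (1 / 4) * hq
    · simp only [Prod.mk.injEq]
      constructor
      · ring
      · linear_combination (-1 / 4) * hq

lemma symBidisk_open : IsOpen symBidisk := by
  rw [symBidisk_eq, ← isClosed_compl_iff]
  have hcl : IsClosed {y : (ℂ × ℂ) × Metric.closedBall (0 : ℂ) 1 |
      1 - y.1.1 * (y.2 : ℂ) + y.1.2 * (y.2 : ℂ) ^ 2 = 0} :=
    isClosed_eq (by fun_prop) (by fun_prop)
  have : CompactSpace (Metric.closedBall (0 : ℂ) 1) :=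
    isCompact_iff_compactSpace.1 (isCompact_closedBall _ _)
  have := isClosedMap_fst_of_compactSpace _ hcl
  convert this using 1
  ext x
  simp
  
end SymBidiskAux

namespace SymBidiskAux

lemma colligation_of_gram {ι H U Y : Type*} [NormedAddCommGroup H] [InnerProductSpace ℂ H]
    [CompleteSpace H] [NormedAddCommGroup U] [InnerProductSpace ℂ U] [CompleteSpace U]
    [NormedAddCommGroup Y] [InnerProductSpace ℂ Y] [CompleteSpace Y]
    (x y : ι → H) (a : ι → U) (b : ι → Y)
    (h : ∀ i j, inner ℂ (x i) (x j) + inner ℂ (a i) (a j)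
      = inner ℂ (y i) (y j) + inner ℂ (b i) (b j)) :
    ∃ (α : H →L[ℂ] H) (β : U →L[ℂ] H) (γ : H →L[ℂ] Y) (δ : U →L[ℂ] Y),
      (∀ (k : H) (u : U), ‖α k + β u‖ ^ 2 + ‖γ k + δ u‖ ^ 2 ≤ ‖k‖ ^ 2 + ‖u‖ ^ 2) ∧
      (∀ i, α (x i) + β (a i) = y i) ∧ (∀ i, γ (x i) + δ (a i) = b i) := by
  obtain ⟨T, hT, hTx, -⟩ := gram_contraction
    (fun i => WithLp.toLp 2 (x i, a i)) (fun i => WithLp.toLp 2 (y i, b i)) (by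
      intro i j
      simpa [WithLp.prod_inner_apply] using h i j)
  let eU : WithLp 2 (H × U) ≃L[ℂ] H × U := WithLp.prodContinuousLinearEquiv 2 ℂ H U
  let eY : WithLp 2 (H × Y) ≃L[ℂ] H × Y := WithLp.prodContinuousLinearEquiv 2 ℂ H Y
  let S : H × U →L[ℂ] H × Y := (eY : _ →L[ℂ] _) ∘L T ∘L (eU.symm : _ →L[ℂ] _)
  have hS : ∀ k u, S (k, u) = ((T (WithLp.toLp 2 (k, u))).fst, (T (WithLp.toLp 2 (k, u))).snd) :=
    fun k u => rfl
  have hsplit : ∀ k u, S (k, 0) + S (0, u) = S (k, u) := by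
    intro k u; rw [← map_add]; simp
  refine ⟨fst ℂ H Y ∘L S ∘L inl ℂ H U, fst ℂ H Y ∘L S ∘L inr ℂ H U,
    snd ℂ H Y ∘L S ∘L inl ℂ H U, snd ℂ H Y ∘L S ∘L inr ℂ H U, ?_, ?_, ?_⟩
  · intro k u
    simp only [comp_apply, inl_apply, inr_apply, coe_fst', coe_snd']
    rw [← Prod.fst_add, ← Prod.snd_add, hsplit, hS]
    have h1 := hT (WithLp.toLp 2 (k, u))
    have h2 := pow_le_pow_left₀ (norm_nonneg _) h1 2
    rw [WithLp.prod_norm_sq_eq_of_L2, WithLp.prod_norm_sq_eq_of_L2] at h2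
    exact h2
  · intro i
    simp only [comp_apply, inl_apply, inr_apply, coe_fst']
    rw [← Prod.fst_add, hsplit, hS, hTx]; rfl
  · intro i
    simp only [comp_apply, inl_apply, inr_apply, coe_snd']
    rw [← Prod.snd_add, hsplit, hS, hTx]; rfl

lemma forward_of_agler {U Y M : Type*}
    [NormedAddCommGroup U] [InnerProductSpace ℂ U] [CompleteSpace U]
    [NormedAddCommGroup Y] [InnerProductSpace ℂ Y] [CompleteSpace Y]
    [NormedAddCommGroup M] [InnerProductSpace ℂ M] [CompleteSpace M]
    (f : ℂ → ℂ → (U →L[ℂ] Y)) (hsym : ∀ z ζ, f z ζ = f ζ z) (v₁ v₂ : ℂ → ℂ → U → M)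
    (hA : ∀ z ζ z' ζ' : ℂ, ‖z‖ < 1 → ‖ζ‖ < 1 → ‖z'‖ < 1 → ‖ζ'‖ < 1 → ∀ u u' : U,
      inner ℂ u' u - inner ℂ (f z' ζ' u') (f z ζ u) =
        (1 - (starRingEnd ℂ) z' * z) * inner ℂ (v₁ z' ζ' u') (v₁ z ζ u) +
        (1 - (starRingEnd ℂ) ζ' * ζ) * inner ℂ (v₂ z' ζ' u') (v₂ z ζ u)) :
    ∃ (α₁ α₂ : WithLp 2 (M × M) →L[ℂ] WithLp 2 (M × M)) (β : U →L[ℂ] WithLp 2 (M × M))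
      (γ : WithLp 2 (M × M) →L[ℂ] Y) (δ : U →L[ℂ] Y),
        GColligationContractive α₁ α₂ β γ δ ∧
          ∀ z ζ : ℂ, ‖z‖ < 1 → ‖ζ‖ < 1 →
            IsUnit ((1 : WithLp 2 (M × M) →L[ℂ] WithLp 2 (M × M))
              - ((z + ζ) / 2) • (α₁ + α₂) + (z * ζ) • (α₁ * α₂)) ∧
              f z ζ = gTransfer α₁ α₂ β γ δ (z + ζ) (z * ζ) := by
  let ι := {w : ℂ × ℂ × U // ‖w.1‖ < 1 ∧ ‖w.2.1‖ < 1}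
  let a : ι → WithLp 2 (M × M) := fun i =>
    WithLp.toLp 2 (v₁ i.1.1 i.1.2.1 i.1.2.2, v₂ i.1.2.1 i.1.1 i.1.2.2)
  let b : ι → WithLp 2 (M × M) := fun i =>
    WithLp.toLp 2 (v₁ i.1.2.1 i.1.1 i.1.2.2, v₂ i.1.1 i.1.2.1 i.1.2.2)
  let z : ι → ℂ := fun i => i.1.1
  let ζ : ι → ℂ := fun i => i.1.2.1
  let e : ι → U := fun i => i.1.2.2
  let F : ι → Y := fun i => f (z i) (ζ i) (e i)
  -- the two fundamental identities
  have I1 : ∀ i j, inner ℂ (z i • a i - ζ i • b i) (z j • a j - ζ j • b j)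
      = inner ℂ (a i - b i) (a j - b j) := by
    intro i j
    have E1 := hA (z j) (ζ j) (z i) (ζ i) j.2.1 j.2.2 i.2.1 i.2.2 (e j) (e i)
    have E2 := hA (ζ j) (z j) (ζ i) (z i) j.2.2 j.2.1 i.2.2 i.2.1 (e j) (e i)
    have E3 := hA (ζ j) (z j) (z i) (ζ i) j.2.2 j.2.1 i.2.1 i.2.2 (e j) (e i)
    have E4 := hA (z j) (ζ j) (ζ i) (z i) j.2.1 j.2.2 i.2.2 i.2.1 (e j) (e i)
    rw [hsym (ζ j) (z j)] at E2 E3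
    rw [hsym (ζ i) (z i)] at E2 E4
    simp only [inner_sub_left, inner_sub_right, inner_smul_left, inner_smul_right, a, b,
      WithLp.prod_inner_apply]
    simp only [z, ζ, e] at E1 E2 E3 E4 ⊢
    linear_combination E1 + E2 - E3 - E4
  have I2 : ∀ i j, (1 - (starRingEnd ℂ) (z i) * z j) * inner ℂ (a i) (a j)
      + (1 - (starRingEnd ℂ) (ζ i) * ζ j) * inner ℂ (b i) (b j)
      = 2 * (inner ℂ (e i) (e j) - inner ℂ (F i) (F j)) := by
    intro i j
    have E1 := hA (z j) (ζ j) (z i) (ζ i) j.2.1 j.2.2 i.2.1 i.2.2 (e j) (e i)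
    have E2 := hA (ζ j) (z j) (ζ i) (z i) j.2.2 j.2.1 i.2.2 i.2.1 (e j) (e i)
    rw [hsym (ζ j) (z j), hsym (ζ i) (z i)] at E2
    simp only [a, b, WithLp.prod_inner_apply]
    simp only [z, ζ, e, F] at E1 E2 ⊢
    linear_combination - E1 - E2
  obtain ⟨L, hL, hLx, -⟩ := gram_contraction (fun i => z i • a i - ζ i • b i)
    (fun i => a i - b i) I1
  have hLn : ‖L‖ ≤ 1 := opNorm_le_bound _ zero_le_one (by simpa using hL)
  have hunit : ∀ c : ℂ, ‖c‖ < 1 → IsUnit (1 - c • L) := by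
    intro c hc
    apply isUnit_one_sub_of_norm_lt_one
    rw [norm_smul]
    nlinarith [norm_nonneg c, norm_nonneg L]
  have hw : ∀ i, ∃ w, a i = w - ζ i • L w ∧ b i = w - z i • L w := by
    intro i
    obtain ⟨r, hr⟩ := hunit (ζ i) i.2.2
    have hr1 : ∀ x, (r : WithLp 2 (M × M) →L[ℂ] WithLp 2 (M × M)) x = x - ζ i • L x := by
      intro x; rw [hr]; simp
    let w := (↑r⁻¹ : WithLp 2 (M × M) →L[ℂ] WithLp 2 (M × M)) (a i)
    have hwa : a i = w - ζ i • L w := by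
      rw [← hr1]; simp only [w]; rw [← mul_apply_eq_comp]; simp
    refine ⟨w, hwa, ?_⟩
    have hinj : ∀ x y, (r : WithLp 2 (M × M) →L[ℂ] WithLp 2 (M × M)) x
        = (r : WithLp 2 (M × M) →L[ℂ] WithLp 2 (M × M)) y → x = y := by
      intro x y hxy
      have := congrArg (↑r⁻¹ : WithLp 2 (M × M) →L[ℂ] WithLp 2 (M × M)) hxy
      rw [← mul_apply_eq_comp, ← mul_apply_eq_comp] at this
      simpa using this
    apply hinj
    rw [hr1, hr1]
    have h1 := hLx i
    simp only [map_sub, map_smul] at h1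
    have h2 : b i - ζ i • L (b i) = a i - z i • L (a i) := by
      rw [sub_eq_iff_eq_add, sub_eq_add_neg, add_assoc, ← sub_eq_iff_eq_add'] 
      rw [← neg_inj, neg_sub, ← h1]; abel
    rw [h2, hwa]
    simp only [map_sub, map_smul, smul_sub]
    rw [smul_comm (ζ i) (z i)]; abel
  choose w hwa hwb using hw
  have J1 : ∀ i, w i - ((z i + ζ i) / 2) • L (w i) = (2 : ℂ)⁻¹ • (a i + b i) := by
    intro i; rw [hwa, hwb]; module
  have J2 : ∀ i, ((z i + ζ i) / 2) • w i - (z i * ζ i) • L (w i)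
      = (2 : ℂ)⁻¹ • (z i • a i + ζ i • b i) := by
    intro i; rw [hwa, hwb]; module
  obtain ⟨α, β, γ, δ, hc, h1, h2⟩ := colligation_of_gram
    (fun i => ((z i + ζ i) / 2) • w i - (z i * ζ i) • L (w i))
    (fun i => w i - ((z i + ζ i) / 2) • L (w i)) e F (by
      intro i j
      have K1 := I1 i j
      have K2 := I2 i j
      simp only [J1, J2]
      simp only [inner_sub_left, inner_sub_right, inner_add_left, inner_add_right,
        inner_smul_left, inner_smul_right, map_inv₀, Complex.conj_ofNat] at K1 ⊢
      linear_combination (-1 / 2) * K2 + (-1 / 4) * K1)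
  refine ⟨α, L, β, γ, δ, ?_, ?_⟩
  · intro k₁ k₂ u
    have A1 := hc k₁ u
    have A2 := pow_le_pow_left₀ (norm_nonneg _) (hL k₂) 2
    linarith
  · intro s t hs ht
    have hα : ∀ k, ‖α k‖ ≤ ‖k‖ := by
      intro k
      have := hc k 0
      simp only [map_zero, add_zero, norm_zero] at this
      refine le_of_sq_le_sq ?_ (norm_nonneg _)
      nlinarith [sq_nonneg ‖γ k‖]
    have hR := isUnit_R α L hα hL s t hs ht
    refine ⟨hR, ?_⟩
    ext u
    let i : ι := ⟨(s, t, u), hs, ht⟩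
    rw [gTransfer_identity α L β γ δ _ _ hR u (w i) (h1 i).symm]
    exact (h2 i).symm

end SymBidiskAux

namespace SymBidiskAux
open Filter Topology

lemma taylor_one {E : Type*} [NormedAddCommGroup E] [NormedSpace ℂ E] [CompleteSpace E]
    (h : ℂ → E) (hd : DifferentiableOn ℂ h (Metric.ball 0 1)) (hb : ∀ z, ‖z‖ < 1 → ‖h z‖ ≤ 1) :
    (∀ j : ℕ, ‖((j.factorial : ℂ)⁻¹) • iteratedDeriv j h 0‖ ≤ 1) ∧
    ∀ z, ‖z‖ < 1 → HasSum (fun j : ℕ => z ^ j • (((j.factorial : ℂ)⁻¹) • iteratedDeriv j h 0)) (h z) := by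
  constructor
  · intro j
    have key : ∀ R : ℝ, 0 < R → R < 1 →
        R ^ j * ‖((j.factorial : ℂ)⁻¹) • iteratedDeriv j h 0‖ ≤ 1 := by
      intro R h0 h1
      have hcl : closure (Metric.ball (0:ℂ) R) ⊆ Metric.ball 0 1 :=
        Metric.closure_ball_subset_closedBall.trans (Metric.closedBall_subset_ball h1)
      have := Complex.norm_iteratedDeriv_le_of_forall_mem_sphere_norm_le (c := 0) (C := 1) j h0
        (DifferentiableOn.diffContOnCl (hd.mono hcl)) (fun z hz => hb z (by
          simp at hz; rw [hz]; exact h1))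
      rw [norm_smul, norm_inv, Complex.norm_natCast]
      have hf : (0:ℝ) < j.factorial := by exact_mod_cast j.factorial_pos
      have hR : 0 < R ^ j := pow_pos h0 j
      rw [le_div_iff₀ hR] at this
      have e : R ^ j * ((j.factorial : ℝ)⁻¹ * ‖iteratedDeriv j h 0‖)
        = (j.factorial : ℝ)⁻¹ * (‖iteratedDeriv j h 0‖ * R ^ j) := by ring
      rw [e, inv_mul_le_iff₀ hf]
      linarith
    have hlim : Tendsto (fun R : ℝ => R ^ j * ‖((j.factorial : ℂ)⁻¹) • iteratedDeriv j h 0‖)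
        (𝓝[<] 1) (𝓝 (1 ^ j * ‖((j.factorial : ℂ)⁻¹) • iteratedDeriv j h 0‖)) := by
      apply tendsto_nhdsWithin_of_tendsto_nhds
      exact (Continuous.tendsto (by fun_prop) _)
    rw [one_pow, one_mul] at hlim
    refine le_of_tendsto hlim ?_
    have : Set.Ioo (0:ℝ) 1 ∈ 𝓝[<] (1:ℝ) := Ioo_mem_nhdsLT (by norm_num)
    filter_upwards [this] with R hR using key R hR.1 hR.2
  · intro z hz
    have := Complex.hasSum_taylorSeries_on_ball (c := 0) (r := 1) (f := h) (z := z)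
      hd (by simpa using hz)
    refine this.congr_fun ?_ |> fun x => x
    intro j
    simp [smul_smul, mul_comm]

lemma partial_deriv {E : Type*} [NormedAddCommGroup E] [NormedSpace ℂ E] [CompleteSpace E]
    (j : ℕ) : ∀ (F : ℂ × ℂ → E), AnalyticOnNhd ℂ F bidisk →
      ∃ G : ℂ × ℂ → E, AnalyticOnNhd ℂ G bidisk ∧
        ∀ z ζ, ‖z‖ < 1 → ‖ζ‖ < 1 → iteratedDeriv j (fun ζ => F (z, ζ)) ζ = G (z, ζ) := by
  induction j with
  | zero => intro F hF; exact ⟨F, hF, fun z ζ _ _ => by simp⟩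
  | succ j ih =>
    intro F hF
    obtain ⟨G, hG, hGe⟩ := ih F hF
    refine ⟨fun w => fderiv ℂ G w (0, 1), ?_, ?_⟩
    · intro w hw
      exact (ContinuousLinearMap.apply ℂ E ((0:ℂ), (1:ℂ))).analyticAt _ |>.comp (hG.fderiv w hw)
    · intro z ζ hz hζ
      rw [iteratedDeriv_succ]
      have hev : iteratedDeriv j (fun ζ => F (z, ζ)) =ᶠ[𝓝 ζ] fun ζ => G (z, ζ) := by
        have : Metric.ball (0:ℂ) 1 ∈ 𝓝 ζ := Metric.isOpen_ball.mem_nhds (by simpa using hζ)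
        filter_upwards [this] with x hx using hGe z x hz (by simpa using hx)
      rw [hev.deriv_eq]
      have h1 : HasFDerivAt G (fderiv ℂ G (z, ζ)) (z, ζ) :=
        (hG (z, ζ) ⟨hz, hζ⟩).differentiableAt.hasFDerivAt
      have h2 : HasDerivAt (fun x : ℂ => (z, x)) ((0:ℂ), (1:ℂ)) ζ :=
        (hasDerivAt_const ζ z).prodMk (hasDerivAt_id ζ)
      exact (h1.comp_hasDerivAt ζ h2).deriv

set_option maxHeartbeats 1000000 in
lemma taylor_two {E : Type*} [NormedAddCommGroup E] [NormedSpace ℂ E] [CompleteSpace E]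
    (F : ℂ × ℂ → E) (hF : AnalyticOnNhd ℂ F bidisk) (hb : ∀ w ∈ bidisk, ‖F w‖ ≤ 1) :
    ∃ a : ℕ → ℕ → E, (∀ i j, ‖a i j‖ ≤ 1) ∧ ∀ z ζ, ‖z‖ < 1 → ‖ζ‖ < 1 →
      HasSum (fun n : ℕ × ℕ => (z ^ n.1 * ζ ^ n.2) • a n.1 n.2) (F (z, ζ)) := by
  choose G hG hGe using fun j => partial_deriv j F hF
  let A : ℕ → ℂ → E := fun j z => ((j.factorial : ℂ)⁻¹) • G j (z, 0)
  have h1 : ∀ z, ‖z‖ < 1 → (∀ j, ‖A j z‖ ≤ 1) ∧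
      ∀ ζ, ‖ζ‖ < 1 → HasSum (fun j : ℕ => ζ ^ j • A j z) (F (z, ζ)) := by
    intro z hz
    have hd : DifferentiableOn ℂ (fun ζ => F (z, ζ)) (Metric.ball 0 1) := by
      intro ζ hζ
      have hζ' : ‖ζ‖ < 1 := by simpa using hζ
      have h1 : DifferentiableAt ℂ F (z, ζ) := (hF (z, ζ) ⟨hz, hζ'⟩).differentiableAt
      have h2 : DifferentiableAt ℂ (fun x : ℂ => (z, x)) ζ := by fun_prop
      exact (DifferentiableAt.comp ζ h1 h2).differentiableWithinAt
    obtain ⟨e1, e2⟩ := taylor_one _ hd (fun ζ hζ => hb _ ⟨hz, hζ⟩)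
    have : ∀ j, iteratedDeriv j (fun ζ => F (z, ζ)) 0 = G j (z, 0) :=
      fun j => hGe j z 0 hz (by simp)
    simp only [this] at e1 e2
    exact ⟨e1, e2⟩
  have h2 : ∀ j, DifferentiableOn ℂ (A j) (Metric.ball 0 1) := by
    intro j z hz
    have hz' : ‖z‖ < 1 := by simpa using hz
    have h1 : DifferentiableAt ℂ (G j) (z, 0) := (hG j (z, 0) ⟨hz', by simp⟩).differentiableAt
    have h2 : DifferentiableAt ℂ (fun x : ℂ => (x, (0:ℂ))) z := by fun_prop
    exact ((DifferentiableAt.comp z h1 h2).const_smul _).differentiableWithinAt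
  have h3 := fun j => taylor_one (A j) (h2 j) (fun z hz => (h1 z hz).1 j)
  refine ⟨fun i j => ((i.factorial : ℂ)⁻¹) • iteratedDeriv i (A j) 0, fun i j => (h3 j).1 i, ?_⟩
  intro z ζ hz hζ
  set a : ℕ → ℕ → E := fun i j => ((i.factorial : ℂ)⁻¹) • iteratedDeriv i (A j) 0 with ha
  have hs : Summable (fun n : ℕ × ℕ => (z ^ n.1 * ζ ^ n.2) • a n.1 n.2) := by
    have hz1 : Summable (fun i : ℕ => ‖z‖ ^ i) := summable_geometric_of_lt_one (norm_nonneg _) hz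
    have hz2 : Summable (fun i : ℕ => ‖ζ‖ ^ i) := summable_geometric_of_lt_one (norm_nonneg _) hζ
    have := hz1.mul_of_nonneg hz2 (fun i => by positivity) (fun i => by positivity)
    refine Summable.of_norm_bounded this ?_
    intro n
    rw [norm_smul, norm_mul, norm_pow, norm_pow]
    exact mul_le_of_le_one_right (by positivity) ((h3 n.2).1 n.1)
  have hs' : HasSum (fun n : ℕ × ℕ => (z ^ n.2 * ζ ^ n.1) • a n.2 n.1)
      (∑' n : ℕ × ℕ, (z ^ n.1 * ζ ^ n.2) • a n.1 n.2) :=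
    (Equiv.prodComm ℕ ℕ).hasSum_iff.mpr hs.hasSum
  have h4 : HasSum (fun j : ℕ => ζ ^ j • A j z)
      (∑' n : ℕ × ℕ, (z ^ n.1 * ζ ^ n.2) • a n.1 n.2) := by
    refine hs'.prod_fiberwise fun j => ?_
    have := ((h3 j).2 z hz).const_smul (ζ ^ j)
    refine this.congr_fun ?_ |> fun x => x
    intro i
    simp only [ha, smul_smul]
    congr 1; ring
  have := h4.unique ((h1 z hz).2 ζ hζ)
  rw [← this]
  exact hs.hasSum
end SymBidiskAux

namespace SymBidiskAux
open Filter Topology MeasureTheory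

/-- the two-torus -/
abbrev Tor : Type := UnitAddCircle × UnitAddCircle

/-- normalized Haar measure on the two-torus -/
def torMeas : Measure Tor := (AddCircle.haarAddCircle (T := (1:ℝ))).prod AddCircle.haarAddCircle

instance : IsProbabilityMeasure torMeas := by unfold torMeas; infer_instance

/-- characters of the two-torus -/
def chi (d : ℤ × ℤ) (x : Tor) : ℂ := fourier d.1 x.1 * fourier d.2 x.2

lemma chi_cont (d : ℤ × ℤ) : Continuous (chi d) := by
  unfold chi
  exact ((fourier d.1).continuous.comp continuous_fst).mul
    ((fourier d.2).continuous.comp continuous_snd)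

lemma chi_add (d e : ℤ × ℤ) (x : Tor) : chi (d + e) x = chi d x * chi e x := by
  simp only [chi, Prod.fst_add, Prod.snd_add, fourier_add]; ring

lemma chi_neg (d : ℤ × ℤ) (x : Tor) : chi (-d) x = (starRingEnd ℂ) (chi d x) := by
  simp only [chi, Prod.fst_neg, Prod.snd_neg, fourier_neg, map_mul]

lemma fourier_norm1 (n : ℤ) (t : UnitAddCircle) : ‖(fourier n t : ℂ)‖ = 1 := by
  rw [fourier_apply]; exact Circle.norm_coe _

lemma chi_norm (d : ℤ × ℤ) (x : Tor) : ‖chi d x‖ = 1 := by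
  simp only [chi, norm_mul, fourier_norm1, mul_one]

lemma fourier_one_pow (n : ℕ) (x : UnitAddCircle) : (fourier 1 x : ℂ) ^ n = fourier (n : ℤ) x := by
  induction n with
  | zero => simp
  | succ n ih => rw [pow_succ, ih]; push_cast; rw [fourier_add]

lemma integral_fourier' (n : ℤ) : ∫ x, (fourier n x : ℂ) ∂(AddCircle.haarAddCircle (T := (1:ℝ)))
    = if n = 0 then 1 else 0 := by
  have h := orthonormal_iff_ite.mp (orthonormal_fourier (T := (1:ℝ))) 0 n
  rw [ContinuousMap.inner_toLp (@AddCircle.haarAddCircle (1:ℝ) _) (fourier 0) (fourier n)] at h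
  simp only [fourier_zero, map_one, mul_one] at h
  rw [h]
  simp [eq_comm]

lemma integral_chi (d : ℤ × ℤ) : ∫ x, chi d x ∂torMeas = if d = 0 then 1 else 0 := by
  unfold torMeas chi
  rw [integral_prod_mul (fun x : UnitAddCircle => (fourier d.1 x : ℂ))
    (fun x : UnitAddCircle => (fourier d.2 x : ℂ)), integral_fourier', integral_fourier']
  by_cases h1 : d.1 = 0 <;> by_cases h2 : d.2 = 0 <;> simp [h1, h2, Prod.ext_iff]

lemma tor_integrable {f : Tor → ℂ} (hf : Continuous f) : Integrable f torMeas :=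
  hf.integrable_of_hasCompactSupport (HasCompactSupport.of_compactSpace f)

/-- extension of coefficients by zero -/
def ext0 {E : Type*} [Zero E] (a : ℕ → ℕ → E) (d : ℤ × ℤ) : E :=
  if 0 ≤ d.1 ∧ 0 ≤ d.2 then a d.1.toNat d.2.toNat else 0

variable {U Y : Type*}
    [NormedAddCommGroup U] [InnerProductSpace ℂ U]
    [NormedAddCommGroup Y] [InnerProductSpace ℂ Y]

lemma fourier_coef (F : ℂ × ℂ → (U →L[ℂ] Y)) (a : ℕ → ℕ → (U →L[ℂ] Y)) (ha : ∀ i j, ‖a i j‖ ≤ 1)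
    (hs : ∀ z ζ, ‖z‖ < 1 → ‖ζ‖ < 1 →
      HasSum (fun n : ℕ × ℕ => (z ^ n.1 * ζ ^ n.2) • a n.1 n.2) (F (z, ζ)))
    (r : ℝ) (h0 : 0 ≤ r) (h1 : r < 1) (d : ℤ × ℤ) (u : U) (y : Y) :
    ∫ x, chi (-d) x * inner ℂ y (F (r * fourier 1 x.1, r * fourier 1 x.2) u) ∂torMeas
      = (r:ℂ) ^ (d.1.toNat + d.2.toNat) * inner ℂ y (ext0 a d u) := by
  let G : ℕ × ℕ → Tor → ℂ := fun n x =>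
    chi (-d) x * (((r:ℂ) ^ (n.1 + n.2) * chi ((n.1 : ℤ), (n.2 : ℤ)) x) * inner ℂ y (a n.1 n.2 u))
  have hG : ∀ x, HasSum (fun n => G n x)
      (chi (-d) x * inner ℂ y (F (r * fourier 1 x.1, r * fourier 1 x.2) u)) := by
    intro x
    have hn : ∀ t : UnitAddCircle, ‖(r:ℂ) * fourier 1 t‖ < 1 := by
      intro t
      rw [norm_mul, fourier_norm1, mul_one, Complex.norm_real, Real.norm_eq_abs, abs_of_nonneg h0]
      exact h1
    have e1 := hs _ _ (hn x.1) (hn x.2)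
    have e2 := (ContinuousLinearMap.apply ℂ Y u).hasSum e1
    have e3 := ((innerSL ℂ y).hasSum e2).mul_left (chi (-d) x)
    refine e3.congr_fun ?_ |> fun x => x
    intro n
    simp only [G, chi, ContinuousLinearMap.apply_apply, mul_pow, fourier_one_pow,
      innerSL_apply_apply, smul_apply, inner_smul_right, pow_add]
    ring
  have hGc : ∀ n, Continuous (G n) := fun n =>
    (chi_cont _).mul ((continuous_const.mul (chi_cont _)).mul continuous_const)
  have hGn : ∀ n x, ‖G n x‖ ≤ r ^ n.1 * r ^ n.2 * (‖y‖ * ‖u‖) := by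
    intro n x
    simp only [G, norm_mul, chi_norm, one_mul, mul_one, norm_pow, Complex.norm_real, Real.norm_eq_abs,
      abs_of_nonneg h0, pow_add]
    gcongr
    refine (norm_inner_le_norm _ _).trans ?_
    gcongr
    exact ((a n.1 n.2).le_opNorm u).trans (mul_le_of_le_one_left (norm_nonneg _) (ha _ _))
  have hsumr : Summable (fun n : ℕ × ℕ => r ^ n.1 * r ^ n.2 * (‖y‖ * ‖u‖)) := by
    have hz1 : Summable (fun i : ℕ => r ^ i) := summable_geometric_of_lt_one h0 h1
    exact (hz1.mul_of_nonneg hz1 (fun i => by positivity) (fun i => by positivity)).mul_right _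
  have key := hasSum_integral_of_summable_integral_norm (μ := torMeas) (F := G)
    (fun n => tor_integrable (hGc n)) (by
      refine Summable.of_nonneg_of_le (fun n => integral_nonneg fun x => norm_nonneg _) (fun n => ?_) hsumr
      have : ∫ x, ‖G n x‖ ∂torMeas ≤ ∫ x, r ^ n.1 * r ^ n.2 * (‖y‖ * ‖u‖) ∂torMeas :=
        integral_mono (tor_integrable (hGc n)).norm (integrable_const _) (fun x => hGn n x)
      simpa using this)
  have e1 : (∫ x, ∑' n, G n x ∂torMeas)
    = ∫ x, chi (-d) x * inner ℂ y (F (r * fourier 1 x.1, r * fourier 1 x.2) u) ∂torMeas :=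
    integral_congr_ae (Eventually.of_forall fun x => (hG x).tsum_eq)
  rw [e1] at key
  have e2 : ∀ n : ℕ × ℕ, ∫ x, G n x ∂torMeas =
      if ((n.1 : ℤ), (n.2 : ℤ)) = d then (r:ℂ) ^ (n.1 + n.2) * inner ℂ y (a n.1 n.2 u) else 0 := by
    intro n
    have : ∀ x, G n x = ((r:ℂ) ^ (n.1 + n.2) * inner ℂ y (a n.1 n.2 u)) *
        chi (-d + ((n.1 : ℤ), (n.2 : ℤ))) x := by
      intro x; simp only [G, chi_add]; ring
    simp only [this]
    rw [integral_const_mul, integral_chi]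
    have : (-d + ((n.1 : ℤ), (n.2 : ℤ)) = 0) ↔ (((n.1 : ℤ), (n.2 : ℤ)) = d) := by
      rw [neg_add_eq_zero, eq_comm]
    simp [this]
  simp only [e2] at key
  refine key.unique ?_
  unfold ext0
  by_cases hd : 0 ≤ d.1 ∧ 0 ≤ d.2
  · have := hasSum_ite_eq (d.1.toNat, d.2.toNat)
      ((r:ℂ) ^ (d.1.toNat + d.2.toNat) * inner ℂ y (a d.1.toNat d.2.toNat u))
    rw [if_pos hd]
    refine this.congr_fun ?_ |> fun x => x
    intro n
    by_cases hn : n = (d.1.toNat, d.2.toNat)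
    · have : ((n.1 : ℤ), (n.2 : ℤ)) = d := by
        rw [hn]; exact Prod.ext (Int.toNat_of_nonneg hd.1) (Int.toNat_of_nonneg hd.2)
      rw [if_pos this, if_pos hn, hn]
    · have : ((n.1 : ℤ), (n.2 : ℤ)) ≠ d := by
        intro h; apply hn; rw [← h]; simp
      rw [if_neg this, if_neg hn]
  · rw [if_neg hd]
    have : ∀ n : ℕ × ℕ, ((n.1 : ℤ), (n.2 : ℤ)) ≠ d := by
      intro n h; apply hd; rw [← h]; simp
    simp [this]

lemma hself {V : Type*} [NormedAddCommGroup V] [InnerProductSpace ℂ V] (s : Finset (ℤ × ℤ))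
    (v : ℤ × ℤ → V) :
    ∫ x, inner ℂ (∑ k ∈ s, chi (-k) x • v k) (∑ k ∈ s, chi (-k) x • v k) ∂torMeas
      = ((∑ k ∈ s, ‖v k‖ ^ 2 : ℝ) : ℂ) := by
  have e : ∀ x, inner ℂ (∑ k ∈ s, chi (-k) x • v k) (∑ k ∈ s, chi (-k) x • v k)
      = ∑ k ∈ s, ∑ m ∈ s, chi (k - m) x * inner ℂ (v k) (v m) := by
    intro x
    rw [sum_inner]
    refine Finset.sum_congr rfl fun k _ => ?_
    rw [inner_sum]
    refine Finset.sum_congr rfl fun m _ => ?_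
    rw [inner_smul_left, inner_smul_right, ← chi_neg, neg_neg, sub_eq_add_neg, chi_add, mul_assoc]
  simp only [e]
  have hi : ∀ k m, Integrable (fun x => chi (k - m) x * inner ℂ (v k) (v m)) torMeas :=
    fun k m => tor_integrable ((chi_cont _).mul continuous_const)
  rw [integral_finsetSum _ (fun k _ => integrable_finsetSum _ (fun m _ => hi k m))]
  push_cast
  refine Finset.sum_congr rfl fun k hk => ?_
  rw [integral_finsetSum _ (fun m _ => hi k m)]
  simp only [integral_mul_const, integral_chi, sub_eq_zero, ite_mul, one_mul, zero_mul,
    Finset.sum_ite_eq, hk, if_true]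
  rw [inner_self_eq_norm_sq_to_K]
  rfl

lemma gram_pos_r (F : ℂ × ℂ → (U →L[ℂ] Y)) (a : ℕ → ℕ → (U →L[ℂ] Y)) (ha : ∀ i j, ‖a i j‖ ≤ 1)
    (hF : ContinuousOn F bidisk) (hb : ∀ w ∈ bidisk, ‖F w‖ ≤ 1)
    (hs : ∀ z ζ, ‖z‖ < 1 → ‖ζ‖ < 1 →
      HasSum (fun n : ℕ × ℕ => (z ^ n.1 * ζ ^ n.2) • a n.1 n.2) (F (z, ζ)))
    (r : ℝ) (h0 : 0 ≤ r) (h1 : r < 1) (s : Finset (ℤ × ℤ)) (u : ℤ × ℤ → U) (y : ℤ × ℤ → Y) :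
    0 ≤ ∑ k ∈ s, ‖u k‖ ^ 2 + ∑ k ∈ s, ‖y k‖ ^ 2 + 2 * (∑ m ∈ s, ∑ k ∈ s,
      ((r:ℂ) ^ ((k - m).1.toNat + (k - m).2.toNat) * inner ℂ (y m) (ext0 a (k - m) (u k)))).re := by
  let w : Tor → ℂ × ℂ := fun x => (r * fourier 1 x.1, r * fourier 1 x.2)
  have hw : ∀ x, w x ∈ bidisk := by
    intro x
    have hn : ∀ t : UnitAddCircle, ‖(r:ℂ) * fourier 1 t‖ < 1 := by
      intro t
      rw [norm_mul, fourier_norm1, mul_one, Complex.norm_real, Real.norm_eq_abs, abs_of_nonneg h0]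
      exact h1
    exact ⟨hn _, hn _⟩
  have hwc : Continuous w :=
    (continuous_const.mul ((fourier 1).continuous.comp continuous_fst)).prodMk
      (continuous_const.mul ((fourier 1).continuous.comp continuous_snd))
  have hFw : Continuous (fun x => F (w x)) := hF.comp_continuous hwc hw
  let p : Tor → U := fun x => ∑ k ∈ s, chi (-k) x • u k
  let q : Tor → Y := fun x => ∑ k ∈ s, chi (-k) x • y k
  have hcross : ∫ x, inner ℂ (q x) (F (w x) (p x)) ∂torMeas = ∑ m ∈ s, ∑ k ∈ s,
      ((r:ℂ) ^ ((k - m).1.toNat + (k - m).2.toNat) * inner ℂ (y m) (ext0 a (k - m) (u k))) := by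
    have e : ∀ x, inner ℂ (q x) (F (w x) (p x))
        = ∑ m ∈ s, ∑ k ∈ s, chi (-(k - m)) x * inner ℂ (y m) (F (w x) (u k)) := by
      intro x
      simp only [p, q]
      rw [sum_inner]
      refine Finset.sum_congr rfl fun m _ => ?_
      rw [map_sum, inner_sum]
      refine Finset.sum_congr rfl fun k _ => ?_
      rw [map_smul, inner_smul_left, inner_smul_right, ← chi_neg, neg_neg, neg_sub, sub_eq_add_neg,
        chi_add, mul_assoc]
    simp only [e]
    have hi : ∀ k m, Integrable (fun x => chi (-(k - m)) x * inner ℂ (y m) (F (w x) (u k))) torMeas :=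
      fun k m => tor_integrable ((chi_cont _).mul
        (continuous_const.inner (hFw.clm_apply continuous_const)))
    rw [integral_finsetSum _ (fun k _ => integrable_finsetSum _ (fun m _ => hi m k))]
    refine Finset.sum_congr rfl fun m hm => ?_
    rw [integral_finsetSum _ (fun k _ => hi k m)]
    refine Finset.sum_congr rfl fun k hk => ?_
    exact fourier_coef F a ha hs r h0 h1 (k - m) (u k) (y m)
  have hpc : Continuous p := continuous_finsetSum _ fun k _ => (chi_cont _).smul continuous_const
  have hqc : Continuous q := continuous_finsetSum _ fun k _ => (chi_cont _).smul continuous_const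
  have i1 : Integrable (fun x => inner ℂ (p x) (p x)) torMeas := tor_integrable (hpc.inner hpc)
  have i2 : Integrable (fun x => inner ℂ (q x) (q x)) torMeas := tor_integrable (hqc.inner hqc)
  have i3 : Integrable (fun x => inner ℂ (q x) (F (w x) (p x))) torMeas :=
    tor_integrable (hqc.inner (hFw.clm_apply hpc))
  have i12 : Integrable (fun x => inner ℂ (p x) (p x) + inner ℂ (q x) (q x)) torMeas := i1.add i2
  have i3' : Integrable (fun x => 2 * inner ℂ (q x) (F (w x) (p x))) torMeas := i3.const_mul 2
  have i123 : Integrable (fun x => inner ℂ (p x) (p x) + inner ℂ (q x) (q x)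
      + 2 * inner ℂ (q x) (F (w x) (p x))) torMeas := i12.add i3'
  have htot : ∫ x, (inner ℂ (p x) (p x) + inner ℂ (q x) (q x)
      + 2 * inner ℂ (q x) (F (w x) (p x))) ∂torMeas
      = ((∑ k ∈ s, ‖u k‖ ^ 2 : ℝ) : ℂ) + ((∑ k ∈ s, ‖y k‖ ^ 2 : ℝ) : ℂ) + 2 * (∑ m ∈ s, ∑ k ∈ s,
      ((r:ℂ) ^ ((k - m).1.toNat + (k - m).2.toNat) * inner ℂ (y m) (ext0 a (k - m) (u k)))) := by
    rw [integral_add i12 i3', integral_add i1 i2, integral_const_mul, hcross]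
    congr 2
    · exact hself s u
    · exact hself s y
  have hre := integral_re i123
  have hpos : 0 ≤ ∫ x, RCLike.re (inner ℂ (p x) (p x) + inner ℂ (q x) (q x)
      + 2 * inner ℂ (q x) (F (w x) (p x))) ∂torMeas := by
    refine integral_nonneg fun x => ?_
    have e1 : ‖inner ℂ (q x) (F (w x) (p x))‖ ≤ ‖q x‖ * ‖p x‖ := by
      refine (norm_inner_le_norm _ _).trans ?_
      gcongr
      exact ((F (w x)).le_opNorm _).trans (mul_le_of_le_one_left (norm_nonneg _) (hb _ (hw x)))
    have e2 := (abs_le.mp ((Complex.abs_re_le_norm _).trans e1)).1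
    have e3 := inner_self_eq_norm_sq (𝕜 := ℂ) (p x)
    have e4 := inner_self_eq_norm_sq (𝕜 := ℂ) (q x)
    simp only [Pi.zero_apply, map_add, e3, e4]
    simp only [RCLike.re_to_complex, Complex.mul_re,
      Complex.re_ofNat, Complex.im_ofNat, zero_mul, sub_zero]
    nlinarith [sq_nonneg (‖p x‖ - ‖q x‖)]
  rw [hre, htot] at hpos
  simp only [RCLike.re_to_complex, Complex.add_re, Complex.ofReal_re, Complex.mul_re (2:ℂ),
      Complex.re_ofNat, Complex.im_ofNat, zero_mul, sub_zero] at hpos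
  exact hpos

lemma gram_pos (F : ℂ × ℂ → (U →L[ℂ] Y)) (a : ℕ → ℕ → (U →L[ℂ] Y)) (ha : ∀ i j, ‖a i j‖ ≤ 1)
    (hF : ContinuousOn F bidisk) (hb : ∀ w ∈ bidisk, ‖F w‖ ≤ 1)
    (hs : ∀ z ζ, ‖z‖ < 1 → ‖ζ‖ < 1 →
      HasSum (fun n : ℕ × ℕ => (z ^ n.1 * ζ ^ n.2) • a n.1 n.2) (F (z, ζ)))
    (s : Finset (ℤ × ℤ)) (u : ℤ × ℤ → U) (y : ℤ × ℤ → Y) :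
    0 ≤ ∑ k ∈ s, ‖u k‖ ^ 2 + ∑ k ∈ s, ‖y k‖ ^ 2 + 2 * (∑ m ∈ s, ∑ k ∈ s,
      inner ℂ (y m) (ext0 a (k - m) (u k))).re := by
  let Φ : ℝ → ℝ := fun r => ∑ k ∈ s, ‖u k‖ ^ 2 + ∑ k ∈ s, ‖y k‖ ^ 2 + 2 * (∑ m ∈ s, ∑ k ∈ s,
      ((r:ℂ) ^ ((k - m).1.toNat + (k - m).2.toNat) * inner ℂ (y m) (ext0 a (k - m) (u k)))).re
  have hc : Continuous Φ := by
    have : Continuous (fun r : ℝ => ∑ m ∈ s, ∑ k ∈ s,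
      ((r:ℂ) ^ ((k - m).1.toNat + (k - m).2.toNat) * inner ℂ (y m) (ext0 a (k - m) (u k)))) := by
      fun_prop
    exact continuous_const.add (continuous_const.mul (Complex.continuous_re.comp this))
  have hlim : Tendsto Φ (𝓝[<] 1) (𝓝 (Φ 1)) := tendsto_nhdsWithin_of_tendsto_nhds (hc.tendsto 1)
  have hΦ : 0 ≤ Φ 1 := by
    refine ge_of_tendsto hlim ?_
    have : Set.Ioo (0:ℝ) 1 ∈ 𝓝[<] (1:ℝ) := Ioo_mem_nhdsLT (by norm_num)
    filter_upwards [this] with r hr using gram_pos_r F a ha hF hb hs r hr.1.le hr.2 s u y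
  simpa [Φ] using hΦ

end SymBidiskAux

namespace SymBidiskAux

lemma gram_space_aux {U : Type*} {Y : Type*} {V : Type u}
    [NormedAddCommGroup U] [InnerProductSpace ℂ U] [CompleteSpace U]
    [NormedAddCommGroup Y] [InnerProductSpace ℂ Y] [CompleteSpace Y]
    [NormedAddCommGroup V] [InnerProductSpace ℂ V] [CompleteSpace V]
    (pU : V →L[ℂ] U) (pY : V →L[ℂ] Y) (iU : U →L[ℂ] V) (iY : Y →L[ℂ] V)
    (a1 : ∀ u, pU (iU u) = u) (a2 : ∀ u, pY (iU u) = 0)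
    (a3 : ∀ y, pU (iY y) = 0) (a4 : ∀ y, pY (iY y) = y)
    (hin : ∀ v w : V, inner ℂ v w = inner ℂ (pU v) (pU w) + inner ℂ (pY v) (pY w))
    (c : ℤ × ℤ → (U →L[ℂ] Y))
    (hpos : ∀ (s : Finset (ℤ × ℤ)) (u : ℤ × ℤ → U) (y : ℤ × ℤ → Y),
      0 ≤ ∑ k ∈ s, ‖u k‖ ^ 2 + ∑ k ∈ s, ‖y k‖ ^ 2 + 2 * (∑ m ∈ s, ∑ k ∈ s,
      inner ℂ (y m) (c (k - m) (u k))).re) :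
    ∃ (M : Type u) (_ : NormedAddCommGroup M) (_ : InnerProductSpace ℂ M)
      (_ : CompleteSpace M) (JU : ℤ × ℤ → U →L[ℂ] M) (JY : ℤ × ℤ → Y →L[ℂ] M)
      (T : ℤ × ℤ → M →L[ℂ] M),
      (∀ m k u u', inner ℂ (JU m u) (JU k u') = if m = k then inner ℂ u u' else 0) ∧
      (∀ m k y y', inner ℂ (JY m y) (JY k y') = if m = k then inner ℂ y y' else 0) ∧
      (∀ m k y u, inner ℂ (JY m y) (JU k u) = inner ℂ y (c (k - m) u)) ∧
      (∀ e m u, T e (JU m u) = JU (m + e) u) ∧ (∀ e m y, T e (JY m y) = JY (m + e) y) ∧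
      (∀ e x y, inner ℂ (T e x) (T e y) = inner ℂ x y) := by
  let K : Matrix (ℤ × ℤ) (ℤ × ℤ) (V →L[ℂ] V) := fun x y =>
    (if x = y then 1 else 0) + adjoint pY ∘L c (y - x) ∘L pU + adjoint pU ∘L adjoint (c (x - y)) ∘L pY
  have hK : ∀ x y v w, inner ℂ (K x y v) w = (if x = y then inner ℂ v w else 0)
      + inner ℂ (c (y - x) (pU v)) (pY w) + inner ℂ (pY v) (c (x - y) (pU w)) := by
    intro x y v w
    simp only [K, add_apply, comp_apply, inner_add_left, adjoint_inner_left]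
    split_ifs <;> simp
  have hherm : K.IsHermitian := by
    ext x y v
    refine ext_inner_right ℂ fun w => ?_
    rw [Matrix.conjTranspose_apply, star_eq_adjoint, adjoint_inner_left, ← inner_conj_symm, hK, hK]
    simp only [map_add, inner_conj_symm]
    by_cases h : x = y
    · subst h; simp only [if_true, inner_conj_symm]; ring
    · rw [if_neg h, if_neg (fun h' => h h'.symm)]; simp only [map_zero]; ring
  have hps : K.PosSemidef := by
    have htf := (RKHS.posSemidef_tfae (K := K)).out 0 2
    refine htf.mpr ⟨hherm, fun vv => ?_⟩
    have h := hpos vv.support (fun k => pU (vv k)) (fun k => pY (vv k))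
    have e : (vv.sum fun x w => vv.sum fun x' w' => inner ℂ (K x' x w) w')
      = ((∑ k ∈ vv.support, ‖pU (vv k)‖ ^ 2 + ∑ k ∈ vv.support, ‖pY (vv k)‖ ^ 2 : ℝ) : ℂ)
        + (starRingEnd ℂ) (∑ m ∈ vv.support, ∑ k ∈ vv.support,
            inner ℂ (pY (vv m)) (c (k - m) (pU (vv k))))
        + (∑ m ∈ vv.support, ∑ k ∈ vv.support,
            inner ℂ (pY (vv m)) (c (k - m) (pU (vv k)))) := by
      simp only [Finsupp.sum, hK, Finset.sum_add_distrib]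
      congr 1
      congr 1
      · push_cast
        rw [← Finset.sum_add_distrib]
        refine Finset.sum_congr rfl fun k hk => ?_
        rw [Finset.sum_ite_eq' vv.support k]
        rw [if_pos hk, hin, inner_self_eq_norm_sq_to_K, inner_self_eq_norm_sq_to_K]
        rfl
      · rw [map_sum]
        simp only [map_sum, inner_conj_symm]
        rw [Finset.sum_comm]
    rw [e]
    simp only [RCLike.re_to_complex, Complex.add_re, Complex.ofReal_re, Complex.conj_re]
    linarith
  have : Fact K.PosSemidef := ⟨hps⟩
  let M := RKHS.OfKernel K
  have hker : ∀ x y v w, inner ℂ (RKHS.kerFun M y v) (RKHS.kerFun M x w) = inner ℂ (K x y v) w := by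
    intro x y v w
    rw [← RKHS.kernel_inner, RKHS.OfKernel.kernel_ofKernel]
  have hshift : ∀ e : ℤ × ℤ, ∃ T : M →L[ℂ] M, (∀ x v, T (RKHS.kerFun M x v) = RKHS.kerFun M (x + e) v)
      ∧ ∀ x y, inner ℂ (T x) (T y) = inner ℂ x y := by
    intro e
    obtain ⟨T, -, hT1, hT2⟩ := gram_contraction (ι := (ℤ × ℤ) × V)
      (fun i => RKHS.kerFun M i.1 i.2) (fun i => RKHS.kerFun M (i.1 + e) i.2) (by
        intro i j
        rw [hker, hker, hK, hK]
        simp)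
    refine ⟨T, fun x v => hT1 (x, v), ?_⟩
    have hd := RKHS.kerFun_dense M
    have hset : {x | ∃ (a : ℤ × ℤ) (b : V), (RKHS.kerFun M a) b = x}
        = Set.range (fun i : (ℤ × ℤ) × V => RKHS.kerFun M i.1 i.2) := by
      ext x; simp
    rw [hset] at hd
    have hn : ∀ a, ‖T a‖ = ‖a‖ := fun a => hT2 a (by rw [hd]; trivial)
    exact (⟨T.toLinearMap, hn⟩ : M →ₗᵢ[ℂ] M).inner_map_map
  choose T hT1 hT2 using hshift
  refine ⟨M, inferInstance, inferInstance, inferInstance,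
    fun m => RKHS.kerFun M m ∘L iU, fun m => RKHS.kerFun M m ∘L iY, T, ?_, ?_, ?_, ?_, ?_, hT2⟩
  · intro m k u u'
    simp only [comp_apply]
    rw [hker, hK, hin]
    simp only [a1, a2, inner_zero_left, inner_zero_right, add_zero, eq_comm]
  · intro m k u u'
    simp only [comp_apply]
    rw [hker, hK, hin]
    simp only [a3, a4, map_zero, inner_zero_left, inner_zero_right, add_zero, zero_add, eq_comm]
  · intro m k y u
    simp only [comp_apply]
    rw [hker, hK, hin]
    simp [a1, a2, a3, a4]
  · intro e m u
    simp only [comp_apply, hT1]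
  · intro e m y
    simp only [comp_apply, hT1]

lemma gram_space {U : Type u} {Y : Type v}
    [NormedAddCommGroup U] [InnerProductSpace ℂ U] [CompleteSpace U]
    [NormedAddCommGroup Y] [InnerProductSpace ℂ Y] [CompleteSpace Y]
    (c : ℤ × ℤ → (U →L[ℂ] Y))
    (hpos : ∀ (s : Finset (ℤ × ℤ)) (u : ℤ × ℤ → U) (y : ℤ × ℤ → Y),
      0 ≤ ∑ k ∈ s, ‖u k‖ ^ 2 + ∑ k ∈ s, ‖y k‖ ^ 2 + 2 * (∑ m ∈ s, ∑ k ∈ s,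
      inner ℂ (y m) (c (k - m) (u k))).re) :
    ∃ (M : Type (max u v)) (_ : NormedAddCommGroup M) (_ : InnerProductSpace ℂ M)
      (_ : CompleteSpace M) (JU : ℤ × ℤ → U →L[ℂ] M) (JY : ℤ × ℤ → Y →L[ℂ] M)
      (T : ℤ × ℤ → M →L[ℂ] M),
      (∀ m k u u', inner ℂ (JU m u) (JU k u') = if m = k then inner ℂ u u' else 0) ∧
      (∀ m k y y', inner ℂ (JY m y) (JY k y') = if m = k then inner ℂ y y' else 0) ∧
      (∀ m k y u, inner ℂ (JY m y) (JU k u) = inner ℂ y (c (k - m) u)) ∧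
      (∀ e m u, T e (JU m u) = JU (m + e) u) ∧ (∀ e m y, T e (JY m y) = JY (m + e) y) ∧
      (∀ e x y, inner ℂ (T e x) (T e y) = inner ℂ x y) := by
  let pU : WithLp 2 (U × Y) →L[ℂ] U := (fst ℂ U Y) ∘L (WithLp.prodContinuousLinearEquiv 2 ℂ U Y : WithLp 2 (U × Y) →L[ℂ] U × Y)
  let pY : WithLp 2 (U × Y) →L[ℂ] Y := (snd ℂ U Y) ∘L (WithLp.prodContinuousLinearEquiv 2 ℂ U Y : WithLp 2 (U × Y) →L[ℂ] U × Y)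
  let iU : U →L[ℂ] WithLp 2 (U × Y) :=
    ((WithLp.prodContinuousLinearEquiv 2 ℂ U Y).symm : U × Y →L[ℂ] WithLp 2 (U × Y)) ∘L inl ℂ U Y
  let iY : Y →L[ℂ] WithLp 2 (U × Y) :=
    ((WithLp.prodContinuousLinearEquiv 2 ℂ U Y).symm : U × Y →L[ℂ] WithLp 2 (U × Y)) ∘L inr ℂ U Y
  have a1 : ∀ u, pU (iU u) = u := fun u => rfl
  have a2 : ∀ u, pY (iU u) = 0 := fun u => rfl
  have a3 : ∀ y, pU (iY y) = 0 := fun u => rfl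
  have a4 : ∀ y, pY (iY y) = y := fun u => rfl
  have hin : ∀ v w : WithLp 2 (U × Y), inner ℂ v w = inner ℂ (pU v) (pU w) + inner ℂ (pY v) (pY w) :=
    fun v w => WithLp.prod_inner_apply v w
  exact gram_space_aux pU pY iU iY a1 a2 a3 a4 hin c hpos

end SymBidiskAux

namespace SymBidiskAux
open Filter Topology

variable {U Y M : Type*}
    [NormedAddCommGroup U] [InnerProductSpace ℂ U]
    [NormedAddCommGroup Y] [InnerProductSpace ℂ Y]
    [NormedAddCommGroup M] [InnerProductSpace ℂ M] [CompleteSpace M]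

/-- embedding of `ℕ²` in `ℤ²` -/
def nz (n : ℕ × ℕ) : ℤ × ℤ := ((n.1 : ℤ), (n.2 : ℤ))

lemma nz_inj : Function.Injective nz := by
  intro a b h
  simp only [nz, Prod.mk.injEq, Nat.cast_inj] at h
  exact Prod.ext h.1 h.2

lemma summable_zz (z ζ : ℂ) (hz : ‖z‖ < 1) (hζ : ‖ζ‖ < 1) :
    Summable (fun n : ℕ × ℕ => ‖z‖ ^ n.1 * ‖ζ‖ ^ n.2) := by
  have hz1 : Summable (fun i : ℕ => ‖z‖ ^ i) := summable_geometric_of_lt_one (norm_nonneg _) hz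
  have hz2 : Summable (fun i : ℕ => ‖ζ‖ ^ i) := summable_geometric_of_lt_one (norm_nonneg _) hζ
  exact hz1.mul_of_nonneg hz2 (fun i => by positivity) (fun i => by positivity)

lemma hasSum_zz (z ζ : ℂ) (hz : ‖z‖ < 1) (hζ : ‖ζ‖ < 1) :
    HasSum (fun n : ℕ × ℕ => z ^ n.1 * ζ ^ n.2) ((1 - z)⁻¹ * (1 - ζ)⁻¹) := by
  have hs : Summable (fun n : ℕ × ℕ => z ^ n.1 * ζ ^ n.2) := by
    refine Summable.of_norm_bounded (summable_zz z ζ hz hζ) fun n => ?_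
    simp
  exact (hasSum_geometric_of_norm_lt_one hz).mul (hasSum_geometric_of_norm_lt_one hζ) hs

/-- generating vector of an orthogonal family -/
def sz {V : Type*} [NormedAddCommGroup V] [InnerProductSpace ℂ V]
    (J : ℤ × ℤ → V →L[ℂ] M) (z ζ : ℂ) (u : V) : M :=
  ∑' n : ℕ × ℕ, (z ^ n.1 * ζ ^ n.2) • J (nz n) u

section orth
variable {V : Type*} [NormedAddCommGroup V] [InnerProductSpace ℂ V] (J : ℤ × ℤ → V →L[ℂ] M)
    (hJ : ∀ m k u u', inner ℂ (J m u) (J k u') = if m = k then inner ℂ u u' else 0)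
include hJ

lemma norm_J (m : ℤ × ℤ) (u : V) : ‖J m u‖ = ‖u‖ := by
  have h := hJ m m u u
  rw [if_pos rfl, inner_self_eq_norm_sq_to_K, inner_self_eq_norm_sq_to_K] at h
  have h2 : ‖J m u‖ ^ 2 = ‖u‖ ^ 2 := by exact_mod_cast h
  exact (sq_eq_sq₀ (norm_nonneg _) (norm_nonneg _)).mp h2

lemma hasSum_sz (z ζ : ℂ) (hz : ‖z‖ < 1) (hζ : ‖ζ‖ < 1) (u : V) :
    HasSum (fun n : ℕ × ℕ => (z ^ n.1 * ζ ^ n.2) • J (nz n) u) (sz J z ζ u) := by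
  refine Summable.hasSum ?_
  refine Summable.of_norm_bounded ((summable_zz z ζ hz hζ).mul_right ‖u‖) fun n => ?_
  rw [norm_smul, norm_J J hJ]
  simp

lemma hasSum_inner_sz (z ζ : ℂ) (hz : ‖z‖ < 1) (hζ : ‖ζ‖ < 1) (u : V) (x : M) :
    HasSum (fun n : ℕ × ℕ => (z ^ n.1 * ζ ^ n.2) * inner ℂ x (J (nz n) u))
      (inner ℂ x (sz J z ζ u)) := by
  have := (innerSL ℂ x).hasSum (hasSum_sz J hJ z ζ hz hζ u)
  simpa only [innerSL_apply_apply, inner_smul_right] using this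

lemma inner_J_sz (z ζ : ℂ) (hz : ‖z‖ < 1) (hζ : ‖ζ‖ < 1) (u w : V) (j : ℕ × ℕ) :
    inner ℂ (J (nz j) w) (sz J z ζ u) = (z ^ j.1 * ζ ^ j.2) * inner ℂ w u := by
  have h := hasSum_inner_sz J hJ z ζ hz hζ u (J (nz j) w)
  refine h.unique ?_
  have := hasSum_ite_eq j ((z ^ j.1 * ζ ^ j.2) * inner ℂ w u)
  refine this.congr_fun ?_ |> fun x => x
  intro n
  rw [hJ]
  by_cases hn : n = j
  · subst hn; simp
  · rw [if_neg (fun h => hn (nz_inj h).symm), if_neg hn, mul_zero]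

lemma inner_J_sz_zero (z ζ : ℂ) (hz : ‖z‖ < 1) (hζ : ‖ζ‖ < 1) (u w : V) (m : ℤ × ℤ)
    (hm : ¬ (0 ≤ m.1 ∧ 0 ≤ m.2)) :
    inner ℂ (J m w) (sz J z ζ u) = 0 := by
  have h := hasSum_inner_sz J hJ z ζ hz hζ u (J m w)
  refine h.unique ?_
  have : ∀ n, (z ^ n.1 * ζ ^ n.2) * inner ℂ (J m w) (J (nz n) u) = 0 := by
    intro n
    rw [hJ, if_neg, mul_zero]
    rintro rfl
    exact hm ⟨by simp [nz], by simp [nz]⟩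
  simp only [this]
  exact hasSum_zero

lemma inner_sz_sz (z ζ z' ζ' : ℂ) (hz : ‖z‖ < 1) (hζ : ‖ζ‖ < 1) (hz' : ‖z'‖ < 1) (hζ' : ‖ζ'‖ < 1)
    (u u' : V) :
    (1 - (starRingEnd ℂ) z' * z) * (1 - (starRingEnd ℂ) ζ' * ζ) *
      inner ℂ (sz J z' ζ' u') (sz J z ζ u) = inner ℂ u' u := by
  have h := hasSum_inner_sz J hJ z ζ hz hζ u (sz J z' ζ' u')
  have n1 : ∀ a b : ℂ, ‖a‖ < 1 → ‖b‖ < 1 → ‖(starRingEnd ℂ) a * b‖ < 1 := by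
    intro a b ha hb
    rw [norm_mul, RCLike.norm_conj]
    nlinarith [norm_nonneg a, norm_nonneg b]
  have ne : ∀ a b : ℂ, ‖a‖ < 1 → ‖b‖ < 1 → 1 - (starRingEnd ℂ) a * b ≠ 0 := by
    intro a b ha hb h0
    have := n1 a b ha hb
    rw [← sub_eq_zero.mp h0] at this
    simp at this
  have h2 := (hasSum_zz _ _ (n1 z' z hz' hz) (n1 ζ' ζ hζ' hζ)).mul_right (inner ℂ u' u)
  have e := h.unique (h2.congr_fun (fun n => by
    rw [← inner_conj_symm, inner_J_sz J hJ z' ζ' hz' hζ' u' u n]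
    simp only [map_mul, map_pow, inner_conj_symm]
    ring))
  rw [e]
  have a1 := ne z' z hz' hz
  have a2 := ne ζ' ζ hζ' hζ
  field_simp

end orth

/-- data of the scattering system -/
structure Scat (c : ℤ × ℤ → (U →L[ℂ] Y)) (JU : ℤ × ℤ → U →L[ℂ] M) (JY : ℤ × ℤ → Y →L[ℂ] M)
      (T : ℤ × ℤ → M →L[ℂ] M) : Prop where
  uu : ∀ m k u u', inner ℂ (JU m u) (JU k u') = if m = k then inner ℂ u u' else 0
  yy : ∀ m k y y', inner ℂ (JY m y) (JY k y') = if m = k then inner ℂ y y' else 0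
  yu : ∀ m k y u, inner ℂ (JY m y) (JU k u) = inner ℂ y (c (k - m) u)
  tU : ∀ e m u, T e (JU m u) = JU (m + e) u
  tY : ∀ e m y, T e (JY m y) = JY (m + e) y
  tt : ∀ e x y, inner ℂ (T e x) (T e y) = inner ℂ x y
  c0 : ∀ d : ℤ × ℤ, ¬ (0 ≤ d.1 ∧ 0 ≤ d.2) → c d = 0

section scat
variable {c : ℤ × ℤ → (U →L[ℂ] Y)} {JU : ℤ × ℤ → U →L[ℂ] M} {JY : ℤ × ℤ → Y →L[ℂ] M}
      {T : ℤ × ℤ → M →L[ℂ] M} (S : Scat c JU JY T)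
      {f : ℂ → ℂ → (U →L[ℂ] Y)}
      (hf : ∀ z ζ, ‖z‖ < 1 → ‖ζ‖ < 1 →
        HasSum (fun n : ℕ × ℕ => (z ^ n.1 * ζ ^ n.2) • c (nz n)) (f z ζ))
include S

lemma Scat.yu0 (m k : ℤ × ℤ) (y : Y) (u : U) (h : k.1 < m.1 ∨ k.2 < m.2) :
    inner ℂ (JY m y) (JU k u) = 0 := by
  rw [S.yu, S.c0]
  · simp
  · simp only [Prod.fst_sub, Prod.snd_sub]; omega

lemma Scat.uy0 (m k : ℤ × ℤ) (y : Y) (u : U) (h : k.1 < m.1 ∨ k.2 < m.2) :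
    inner ℂ (JU k u) (JY m y) = 0 := by
  rw [← inner_conj_symm, S.yu0 m k y u h, map_zero]

/-- membership in the scattering subspace -/
def InS (JU : ℤ × ℤ → U →L[ℂ] M) (JY : ℤ × ℤ → Y →L[ℂ] M) (x : M) : Prop :=
  (∀ m u, ¬ (0 ≤ m.1 ∧ 0 ≤ m.2) → inner ℂ x (JU m u) = 0) ∧
  (∀ m y, (0 ≤ m.1 ∧ 0 ≤ m.2) → inner ℂ x (JY m y) = 0)

/-- the kernel vectors -/
def kv (f : ℂ → ℂ → (U →L[ℂ] Y)) (JU : ℤ × ℤ → U →L[ℂ] M) (JY : ℤ × ℤ → Y →L[ℂ] M)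
    (z ζ : ℂ) (u : U) : M := sz JU z ζ u - sz JY z ζ (f z ζ u)

include hf in
lemma Scat.inner_JY_A (z ζ : ℂ) (hz : ‖z‖ < 1) (hζ : ‖ζ‖ < 1) (u : U) (y : Y) (j : ℕ × ℕ) :
    inner ℂ (JY (nz j) y) (sz JU z ζ u) = (z ^ j.1 * ζ ^ j.2) * inner ℂ y (f z ζ u) := by
  have h := hasSum_inner_sz JU S.uu z ζ hz hζ u (JY (nz j) y)
  refine h.unique ?_
  have hinj : Function.Injective (fun n : ℕ × ℕ => n + j) := add_left_injective j
  rw [← hinj.hasSum_iff]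
  · have e1 := (innerSL ℂ y).hasSum ((ContinuousLinearMap.apply ℂ Y u).hasSum (hf z ζ hz hζ))
    have e2 := e1.mul_left (z ^ j.1 * ζ ^ j.2)
    refine e2.congr_fun ?_ |> fun x => x
    intro n
    simp only [Function.comp, S.yu, innerSL_apply_apply, ContinuousLinearMap.apply_apply,
      smul_apply, inner_smul_right, Prod.fst_add, Prod.snd_add, pow_add]
    have : nz (n + j) - nz j = nz n := by simp [nz]
    rw [this]; ring
  · intro n hn
    rw [S.yu0, mul_zero]
    by_contra hcon
    apply hn
    simp only [nz, not_or, not_lt, Nat.cast_le] at hcon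
    exact ⟨(n.1 - j.1, n.2 - j.2), by ext <;> simp <;> omega⟩

lemma Scat.inner_JU_B (z ζ : ℂ) (hz : ‖z‖ < 1) (hζ : ‖ζ‖ < 1) (u : U) (y : Y) (m : ℤ × ℤ)
    (hm : ¬ (0 ≤ m.1 ∧ 0 ≤ m.2)) : inner ℂ (JU m u) (sz JY z ζ y) = 0 := by
  have h := hasSum_inner_sz JY S.yy z ζ hz hζ y (JU m u)
  refine h.unique ?_
  have : ∀ n, (z ^ n.1 * ζ ^ n.2) * inner ℂ (JU m u) (JY (nz n) y) = 0 := by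
    intro n
    rw [S.uy0, mul_zero]
    simp only [nz]; omega
  simp only [this]
  exact hasSum_zero

include hf in
lemma Scat.kv_mem (z ζ : ℂ) (hz : ‖z‖ < 1) (hζ : ‖ζ‖ < 1) (u : U) :
    InS JU JY (kv f JU JY z ζ u) := by
  constructor
  · intro m w hm
    rw [← inner_conj_symm, kv, inner_sub_right, inner_J_sz_zero JU S.uu z ζ hz hζ u w m hm,
      S.inner_JU_B z ζ hz hζ w _ m hm]
    simp
  · intro m y hm
    obtain ⟨j, rfl⟩ : ∃ j, m = nz j := ⟨(m.1.toNat, m.2.toNat), by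
      ext <;> simp [nz, hm.1, hm.2]⟩
    rw [← inner_conj_symm, kv, inner_sub_right, S.inner_JY_A hf z ζ hz hζ,
      inner_J_sz JY S.yy z ζ hz hζ]
    simp

lemma Scat.inner_B (z ζ : ℂ) (hz : ‖z‖ < 1) (hζ : ‖ζ‖ < 1) (y : Y) (x : M) (hx : InS JU JY x) :
    inner ℂ x (sz JY z ζ y) = 0 := by
  have h := hasSum_inner_sz JY S.yy z ζ hz hζ y x
  refine h.unique ?_
  have : ∀ n, (z ^ n.1 * ζ ^ n.2) * inner ℂ x (JY (nz n) y) = 0 := by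
    intro n
    rw [hx.2 (nz n) y ⟨by simp [nz], by simp [nz]⟩, mul_zero]
  simp only [this]
  exact hasSum_zero

lemma Scat.inner_kv (z ζ : ℂ) (hz : ‖z‖ < 1) (hζ : ‖ζ‖ < 1) (u : U) (x : M) (hx : InS JU JY x) :
    inner ℂ x (kv f JU JY z ζ u) = inner ℂ x (sz JU z ζ u) := by
  rw [kv, inner_sub_right, S.inner_B z ζ hz hζ _ x hx, sub_zero]

include hf in
lemma Scat.inner_kv_kv (z ζ z' ζ' : ℂ) (hz : ‖z‖ < 1) (hζ : ‖ζ‖ < 1) (hz' : ‖z'‖ < 1)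
    (hζ' : ‖ζ'‖ < 1) (u u' : U) :
    (1 - (starRingEnd ℂ) z' * z) * (1 - (starRingEnd ℂ) ζ' * ζ) *
      inner ℂ (kv f JU JY z' ζ' u') (kv f JU JY z ζ u)
      = inner ℂ u' u - inner ℂ (f z' ζ' u') (f z ζ u) := by
  have k1 := S.kv_mem hf z ζ hz hζ u
  have k2 := S.kv_mem hf z' ζ' hz' hζ' u'
  have b1 := S.inner_B z ζ hz hζ (f z ζ u) _ k2
  rw [S.inner_kv z ζ hz hζ u _ k2]
  have b2 := S.inner_B z' ζ' hz' hζ' (f z' ζ' u') _ k1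
  rw [← inner_conj_symm, map_eq_zero] at b2
  have e1 := inner_sz_sz JU S.uu z ζ z' ζ' hz hζ hz' hζ' u u'
  have e2 := inner_sz_sz JY S.yy z ζ z' ζ' hz hζ hz' hζ' (f z ζ u) (f z' ζ' u')
  rw [← e1, ← e2]
  simp only [kv, inner_sub_left, inner_sub_right] at b1 b2 ⊢
  linear_combination (-(1 - (starRingEnd ℂ) z' * z) * (1 - (starRingEnd ℂ) ζ' * ζ)) * b2

lemma Scat.eigen (e : ℕ × ℕ) (z ζ : ℂ) (hz : ‖z‖ < 1) (hζ : ‖ζ‖ < 1) (u : U) (x : M)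
    (hx : InS JU JY x) (hTx : InS JU JY (T (nz e) x)) :
    inner ℂ (T (nz e) x) (kv f JU JY z ζ u)
      = (z ^ e.1 * ζ ^ e.2) * inner ℂ x (kv f JU JY z ζ u) := by
  rw [S.inner_kv z ζ hz hζ u _ hx, S.inner_kv z ζ hz hζ u _ hTx]
  have h := hasSum_inner_sz JU S.uu z ζ hz hζ u (T (nz e) x)
  refine h.unique ?_
  have hinj : Function.Injective (fun n : ℕ × ℕ => n + e) := add_left_injective e
  rw [← hinj.hasSum_iff]
  · have e2 := (hasSum_inner_sz JU S.uu z ζ hz hζ u x).mul_left (z ^ e.1 * ζ ^ e.2)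
    refine e2.congr_fun ?_ |> fun x => x
    intro n
    have : nz (n + e) = nz n + nz e := by simp [nz]
    simp only [Function.comp, this, ← S.tU, S.tt, Prod.fst_add, Prod.snd_add, pow_add]
    ring
  · intro n hn
    have : nz n = (nz n - nz e) + nz e := by simp
    rw [this, ← S.tU, S.tt, hx.1, mul_zero]
    intro hcon
    apply hn
    simp only [nz, Prod.fst_sub, Prod.snd_sub] at hcon
    exact ⟨(n.1 - e.1, n.2 - e.2), by ext <;> simp <;> omega⟩

end scat
end SymBidiskAux

namespace SymBidiskAux

lemma mem_clos_orth {M : Type*} [NormedAddCommGroup M] [InnerProductSpace ℂ M]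
    (G : Set M) (x : M) (h : ∀ g ∈ G, inner ℂ x g = 0) :
    ∀ w ∈ (Submodule.span ℂ G).topologicalClosure, inner ℂ x w = 0 := by
  have hle : (Submodule.span ℂ G).topologicalClosure ≤ LinearMap.ker (innerSL ℂ x : M →ₗ[ℂ] ℂ) := by
    refine Submodule.topologicalClosure_minimal _ (Submodule.span_le.mpr fun g hg => ?_) ?_
    · simpa using h g hg
    · exact (innerSL ℂ x).isClosed_ker
  intro w hw
  have := hle hw
  simpa using this

lemma map_clos {M : Type*} [NormedAddCommGroup M] [InnerProductSpace ℂ M]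
    (G : Set M) (T : M →L[ℂ] M) (h : ∀ g ∈ G, T g ∈ (Submodule.span ℂ G).topologicalClosure) :
    ∀ w ∈ (Submodule.span ℂ G).topologicalClosure,
      T w ∈ (Submodule.span ℂ G).topologicalClosure := by
  have hle : (Submodule.span ℂ G).topologicalClosure ≤
      ((Submodule.span ℂ G).topologicalClosure).comap (T : M →ₗ[ℂ] M) := by
    refine Submodule.topologicalClosure_minimal _ (Submodule.span_le.mpr fun g hg => h g hg) ?_
    exact (Submodule.isClosed_topologicalClosure _).preimage T.continuous
  exact fun w hw => hle hw

lemma defect_inner {M : Type*} [NormedAddCommGroup M] [InnerProductSpace ℂ M]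
    (T : M →L[ℂ] M) (tt : ∀ x y, inner ℂ (T x) (T y) = inner ℂ x y) (a a' : M) (l l' : ℂ)
    (h1 : inner ℂ (T a') a = l * inner ℂ a' a) (h2 : inner ℂ (T a) a' = l' * inner ℂ a a') :
    inner ℂ (a' - l' • T a') (a - l • T a) = (1 - (starRingEnd ℂ) l' * l) * inner ℂ a' a := by
  have h3 : inner ℂ a' (T a) = (starRingEnd ℂ) l' * inner ℂ a' a := by
    rw [← inner_conj_symm, h2, map_mul, inner_conj_symm]
  simp only [inner_sub_left, inner_sub_right, inner_smul_left, inner_smul_right, h1, h3, tt]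
  ring

lemma scat_agler {U Y M : Type*}
    [NormedAddCommGroup U] [InnerProductSpace ℂ U]
    [NormedAddCommGroup Y] [InnerProductSpace ℂ Y]
    [NormedAddCommGroup M] [InnerProductSpace ℂ M] [CompleteSpace M]
    {c : ℤ × ℤ → (U →L[ℂ] Y)} {JU : ℤ × ℤ → U →L[ℂ] M} {JY : ℤ × ℤ → Y →L[ℂ] M}
    {T : ℤ × ℤ → M →L[ℂ] M} (S : Scat c JU JY T)
    {f : ℂ → ℂ → (U →L[ℂ] Y)}
    (hf : ∀ z ζ, ‖z‖ < 1 → ‖ζ‖ < 1 →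
      HasSum (fun n : ℕ × ℕ => (z ^ n.1 * ζ ^ n.2) • c (nz n)) (f z ζ)) :
    ∃ v₁ v₂ : ℂ → ℂ → U → M,
    ∀ z ζ z' ζ' : ℂ, ‖z‖ < 1 → ‖ζ‖ < 1 → ‖z'‖ < 1 → ‖ζ'‖ < 1 → ∀ u u' : U,
      inner ℂ u' u - inner ℂ (f z' ζ' u') (f z ζ u) =
        (1 - (starRingEnd ℂ) z' * z) * inner ℂ (v₁ z' ζ' u') (v₁ z ζ u) +
        (1 - (starRingEnd ℂ) ζ' * ζ) * inner ℂ (v₂ z' ζ' u') (v₂ z ζ u) := by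
  -- closed span of JU(B)
  let GB : Set M := {x | ∃ (m : ℤ × ℤ) (u : U), m.1 < 0 ∧ 0 ≤ m.2 ∧ x = JU m u}
  let WB := (Submodule.span ℂ GB).topologicalClosure
  have : CompleteSpace WB := (Submodule.isClosed_topologicalClosure _).completeSpace_coe
  have hGW : ∀ g ∈ GB, g ∈ WB := fun g hg =>
    Submodule.le_topologicalClosure _ (Submodule.subset_span hg)
  let P : ℤ × ℤ → Y → M := fun m y => WB.starProjection (JY m y)
  have hP : ∀ m y, P m y ∈ WB := fun m y => Submodule.starProjection_apply_mem _ _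
  let E : ℤ × ℤ → Y → M := fun m y => JY m y - P m y
  have hE_WB : ∀ m y, ∀ w ∈ WB, inner ℂ (E m y) w = 0 := fun m y w hw =>
    Submodule.starProjection_inner_eq_zero _ w hw
  have hE_S : ∀ m y, m.1 < 0 → 0 ≤ m.2 → InS JU JY (E m y) := by
    intro m y h1 h2
    constructor
    · intro n w hn
      by_cases hB : n.1 < 0 ∧ 0 ≤ n.2
      · exact hE_WB m y _ (hGW _ ⟨n, w, hB.1, hB.2, rfl⟩)
      · have hn2 : n.2 < 0 := by omega
        have e1 : inner ℂ (JY m y) (JU n w) = 0 := S.yu0 m n y w (by omega)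
        have e2 : inner ℂ (JU n w) (P m y) = 0 := by
          refine mem_clos_orth GB _ ?_ _ (hP m y)
          rintro _ ⟨k, w', hk1, hk2, rfl⟩
          rw [S.uu, if_neg]
          rintro rfl; omega
        rw [← inner_conj_symm, map_eq_zero] at e2
        simp only [E, inner_sub_left, e1, e2, sub_zero]
    · intro n y' hn
      have e1 : inner ℂ (JY m y) (JY n y') = 0 := by
        rw [S.yy, if_neg]
        rintro rfl; omega
      have e2 : inner ℂ (JY n y') (P m y) = 0 := by
        refine mem_clos_orth GB _ ?_ _ (hP m y)
        rintro _ ⟨k, w', hk1, hk2, rfl⟩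
        exact S.yu0 _ _ _ _ (by omega)
      rw [← inner_conj_symm, map_eq_zero] at e2
      simp only [E, inner_sub_left, e1, e2, sub_zero]
  have ht2 : nz (0, 1) = ((0 : ℤ), (1 : ℤ)) := by simp [nz]
  have ht1 : nz (1, 0) = ((1 : ℤ), (0 : ℤ)) := by simp [nz]
  have hTE : ∀ m y, m.1 < 0 → 0 ≤ m.2 → T (nz (0, 1)) (E m y) = E (m + nz (0, 1)) y := by
    intro m y h1 h2
    have hmem : T (nz (0, 1)) (P m y) ∈ WB := by
      refine map_clos GB (T (nz (0, 1))) ?_ _ (hP m y)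
      rintro _ ⟨k, w, hk1, hk2, rfl⟩
      rw [S.tU]
      refine hGW _ ⟨_, w, ?_, ?_, rfl⟩ <;> rw [ht2] <;> simp only [Prod.fst_add, Prod.snd_add] <;> omega
    have horth : ∀ w ∈ WB, inner ℂ (T (nz (0, 1)) (E m y)) w = 0 := by
      refine mem_clos_orth GB _ ?_
      rintro _ ⟨k, w, hk1, hk2, rfl⟩
      have hk : k = (k - nz (0, 1)) + nz (0, 1) := by simp
      rw [hk, ← S.tU, S.tt]
      refine (hE_S m y h1 h2).1 _ _ ?_
      rw [ht2]; simp only [Prod.fst_sub, Prod.snd_sub]; omega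
    have hTE' : T (nz (0, 1)) (E m y) = JY (m + nz (0, 1)) y - T (nz (0, 1)) (P m y) := by
      simp only [E, map_sub, S.tY]
    have : P (m + nz (0, 1)) y = T (nz (0, 1)) (P m y) := by
      refine Submodule.eq_starProjection_of_mem_of_inner_eq_zero hmem ?_
      intro w hw
      rw [← hTE']
      exact horth w hw
    rw [hTE', ← this]
  let GE : Set M := {x | ∃ (m : ℤ × ℤ) (y : Y), m.1 < 0 ∧ 0 ≤ m.2 ∧ x = E m y}
  let S2 := (Submodule.span ℂ GE).topologicalClosure
  have : CompleteSpace S2 := (Submodule.isClosed_topologicalClosure _).completeSpace_coe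
  have hGS2 : ∀ g ∈ GE, g ∈ S2 := fun g hg =>
    Submodule.le_topologicalClosure _ (Submodule.subset_span hg)
  have hS2_S : ∀ x ∈ S2, InS JU JY x := by
    intro x hx
    constructor
    · intro m u hm
      rw [← inner_conj_symm, map_eq_zero]
      refine mem_clos_orth GE _ ?_ x hx
      rintro _ ⟨k, y, hk1, hk2, rfl⟩
      rw [← inner_conj_symm, map_eq_zero]
      exact (hE_S k y hk1 hk2).1 m u hm
    · intro m u hm
      rw [← inner_conj_symm, map_eq_zero]
      refine mem_clos_orth GE _ ?_ x hx
      rintro _ ⟨k, y, hk1, hk2, rfl⟩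
      rw [← inner_conj_symm, map_eq_zero]
      exact (hE_S k y hk1 hk2).2 m u hm
  have hS2_T : ∀ x ∈ S2, T (nz (0, 1)) x ∈ S2 := by
    refine map_clos GE _ ?_
    rintro _ ⟨k, y, hk1, hk2, rfl⟩
    rw [hTE k y hk1 hk2]
    refine hGS2 _ ⟨_, y, ?_, ?_, rfl⟩ <;> rw [ht2] <;> simp only [Prod.fst_add, Prod.snd_add] <;> omega
  let InS1 : M → Prop := fun x => (∀ m u, ¬ (0 ≤ m.1 ∧ 0 ≤ m.2) → inner ℂ x (JU m u) = 0) ∧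
    (∀ m y, 0 ≤ m.2 → inner ℂ x (JY m y) = 0)
  have hS1_S : ∀ x, InS1 x → InS JU JY x := fun x hx => ⟨hx.1, fun m y hm => hx.2 m y hm.2⟩
  have hS1_T : ∀ x, InS1 x → InS1 (T (nz (1, 0)) x) := by
    intro x hx
    constructor
    · intro m u hm
      have hk : m = (m - nz (1, 0)) + nz (1, 0) := by simp
      rw [hk, ← S.tU, S.tt]
      refine hx.1 _ _ ?_
      rw [ht1]; simp only [Prod.fst_sub, Prod.snd_sub]; omega
    · intro m u hm
      have hk : m = (m - nz (1, 0)) + nz (1, 0) := by simp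
      rw [hk, ← S.tY, S.tt]
      refine hx.2 _ _ ?_
      rw [ht1]; simp only [Prod.snd_sub]; omega
  have hWB_of : ∀ x, (∀ m u, ¬ (0 ≤ m.1 ∧ 0 ≤ m.2) → inner ℂ x (JU m u) = 0) →
      ∀ w ∈ WB, inner ℂ x w = 0 := by
    intro x hx
    refine mem_clos_orth GB _ ?_
    rintro _ ⟨k, u, hk1, hk2, rfl⟩
    exact hx k u (by omega)
  have hS1_S2 : ∀ x, InS1 x → ∀ w ∈ S2, inner ℂ x w = 0 := by
    intro x hx
    refine mem_clos_orth GE _ ?_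
    rintro _ ⟨k, y, hk1, hk2, rfl⟩
    simp only [E, inner_sub_right, hx.2 k y hk2, hWB_of x hx.1 _ (hP k y), sub_zero]
  have hS_S1 : ∀ x, InS JU JY x → (∀ w ∈ S2, inner ℂ x w = 0) → InS1 x := by
    intro x hx hw
    refine ⟨hx.1, fun m y hm => ?_⟩
    by_cases h1 : 0 ≤ m.1
    · exact hx.2 m y ⟨h1, hm⟩
    · have e1 := hw _ (hGS2 _ ⟨m, y, not_le.mp h1, hm, rfl⟩)
      simp only [E, inner_sub_right, hWB_of x hx.1 _ (hP m y), sub_zero] at e1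
      exact e1
  -- decomposition of the kernel vectors
  let a2 : ℂ → ℂ → U → M := fun z ζ u => S2.starProjection (kv f JU JY z ζ u)
  let a1 : ℂ → ℂ → U → M := fun z ζ u => kv f JU JY z ζ u - a2 z ζ u
  have ha2 : ∀ z ζ u, a2 z ζ u ∈ S2 := fun z ζ u => Submodule.starProjection_apply_mem _ _
  have ha1o : ∀ z ζ u, ∀ w ∈ S2, inner ℂ (a1 z ζ u) w = 0 := fun z ζ u w hw =>
    Submodule.starProjection_inner_eq_zero _ w hw
  have ha1 : ∀ z ζ, ‖z‖ < 1 → ‖ζ‖ < 1 → ∀ u, InS1 (a1 z ζ u) := by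
    intro z ζ hz hζ u
    refine hS_S1 _ ?_ (ha1o z ζ u)
    have h1 := S.kv_mem hf z ζ hz hζ u
    have h2 := hS2_S _ (ha2 z ζ u)
    constructor
    · intro m w hm
      simp only [a1, inner_sub_left, h1.1 m w hm, h2.1 m w hm, sub_zero]
    · intro m w hm
      simp only [a1, inner_sub_left, h1.2 m w hm, h2.2 m w hm, sub_zero]
  have hka : ∀ z ζ u, kv f JU JY z ζ u = a1 z ζ u + a2 z ζ u := by
    intro z ζ u; simp [a1]
  have k2 : ∀ z ζ u, ∀ x ∈ S2, inner ℂ x (kv f JU JY z ζ u) = inner ℂ x (a2 z ζ u) := by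
    intro z ζ u x hx
    have := ha1o z ζ u x hx
    rw [← inner_conj_symm, map_eq_zero] at this
    rw [hka, inner_add_right, this, zero_add]
  have k1 : ∀ z ζ u, ∀ x, InS1 x → inner ℂ x (kv f JU JY z ζ u) = inner ℂ x (a1 z ζ u) := by
    intro z ζ u x hx
    rw [hka, inner_add_right, hS1_S2 x hx _ (ha2 z ζ u), add_zero]
  have eig2 : ∀ z ζ, ‖z‖ < 1 → ‖ζ‖ < 1 → ∀ u, ∀ x ∈ S2,
      inner ℂ (T (nz (0, 1)) x) (a2 z ζ u) = ζ * inner ℂ x (a2 z ζ u) := by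
    intro z ζ hz hζ u x hx
    rw [← k2 _ _ _ _ (hS2_T x hx), ← k2 _ _ _ _ hx,
      S.eigen (0, 1) z ζ hz hζ u x (hS2_S x hx) (hS2_S _ (hS2_T x hx))]
    simp
  have eig1 : ∀ z ζ, ‖z‖ < 1 → ‖ζ‖ < 1 → ∀ u, ∀ x, InS1 x →
      inner ℂ (T (nz (1, 0)) x) (a1 z ζ u) = z * inner ℂ x (a1 z ζ u) := by
    intro z ζ hz hζ u x hx
    rw [← k1 _ _ _ _ (hS1_T x hx), ← k1 _ _ _ _ hx,
      S.eigen (1, 0) z ζ hz hζ u x (hS1_S x hx) (hS1_S _ (hS1_T x hx))]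
    simp
  refine ⟨fun z ζ u => a2 z ζ u - ζ • T (nz (0, 1)) (a2 z ζ u),
    fun z ζ u => a1 z ζ u - z • T (nz (1, 0)) (a1 z ζ u), ?_⟩
  intro z ζ z' ζ' hz hζ hz' hζ' u u'
  rw [defect_inner (T (nz (0, 1))) (S.tt _) (a2 z ζ u) (a2 z' ζ' u') ζ ζ'
      (eig2 z ζ hz hζ u _ (ha2 _ _ _)) (eig2 z' ζ' hz' hζ' u' _ (ha2 _ _ _)),
    defect_inner (T (nz (1, 0))) (S.tt _) (a1 z ζ u) (a1 z' ζ' u') z z'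
      (eig1 z ζ hz hζ u _ (ha1 z' ζ' hz' hζ' u')) (eig1 z' ζ' hz' hζ' u' _ (ha1 z ζ hz hζ u)),
    ← S.inner_kv_kv hf z ζ z' ζ' hz hζ hz' hζ' u u', hka, hka, inner_add_left, inner_add_right,
    inner_add_right, hS1_S2 _ (ha1 z' ζ' hz' hζ' u') _ (ha2 z ζ u)]
  have : inner ℂ (a2 z' ζ' u') (a1 z ζ u) = 0 := by
    rw [← inner_conj_symm, map_eq_zero]
    exact ha1o z ζ u _ (ha2 z' ζ' u')
  rw [this]
  ring

end SymBidiskAux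

theorem schur_class_symmetrized_bidisk_iff_realization {U : Type u} {Y : Type v}
    [NormedAddCommGroup U] [InnerProductSpace ℂ U] [CompleteSpace U]
    [NormedAddCommGroup Y] [InnerProductSpace ℂ Y] [CompleteSpace Y]
    (g : ℂ × ℂ → (U →L[ℂ] Y)) :
    (AnalyticOnNhd ℂ g symBidisk ∧ ∀ w ∈ symBidisk, ‖g w‖ ≤ 1) ↔
      ∃ (H : Type (max u v)) (_ : NormedAddCommGroup H) (_ : InnerProductSpace ℂ H)
        (_ : CompleteSpace H) (α₁ α₂ : H →L[ℂ] H) (β : U →L[ℂ] H) (γ : H →L[ℂ] Y)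
        (δ : U →L[ℂ] Y),
        GColligationContractive α₁ α₂ β γ δ ∧
          ∀ w ∈ symBidisk,
            IsUnit ((1 : H →L[ℂ] H) - (w.1 / 2) • (α₁ + α₂) + w.2 • (α₁ * α₂)) ∧
              g w = gTransfer α₁ α₂ β γ δ w.1 w.2 := by
  constructor
  · rintro ⟨hg, hb⟩
    have hmem : ∀ w : ℂ × ℂ, w ∈ bidisk → (w.1 + w.2, w.1 * w.2) ∈ symBidisk :=
      fun w hw => ⟨w, hw, rfl⟩
    have hF : AnalyticOnNhd ℂ (fun w : ℂ × ℂ => g (w.1 + w.2, w.1 * w.2)) bidisk := by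
      intro w hw
      have hp : AnalyticAt ℂ (fun w : ℂ × ℂ => (w.1 + w.2, w.1 * w.2)) w :=
        (analyticAt_fst.add analyticAt_snd).prod (analyticAt_fst.mul analyticAt_snd)
      exact AnalyticAt.comp' (hg _ (hmem w hw)) hp
    have hFb : ∀ w ∈ bidisk, ‖(fun w : ℂ × ℂ => g (w.1 + w.2, w.1 * w.2)) w‖ ≤ 1 :=
      fun w hw => hb _ (hmem w hw)
    obtain ⟨a, ha, hs⟩ := SymBidiskAux.taylor_two _ hF hFb
    obtain ⟨M, i1, i2, i3, JU, JY, T, uu, yy, yu, tU, tY, tt⟩ :=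
      SymBidiskAux.gram_space (SymBidiskAux.ext0 a)
        (fun s x y => SymBidiskAux.gram_pos _ a ha hF.continuousOn hFb hs s x y)
    have S : SymBidiskAux.Scat (SymBidiskAux.ext0 a) JU JY T :=
      ⟨uu, yy, yu, tU, tY, tt, fun d hd => if_neg hd⟩
    obtain ⟨v₁, v₂, hA⟩ := SymBidiskAux.scat_agler S
      (f := fun z ζ => g (z + ζ, z * ζ)) (by
        intro z ζ hz hζ
        have h := hs z ζ hz hζ
        have e : ∀ n : ℕ × ℕ, SymBidiskAux.ext0 a (SymBidiskAux.nz n) = a n.1 n.2 := by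
          intro n
          simp [SymBidiskAux.ext0, SymBidiskAux.nz]
        simp only [e]
        exact h)
    obtain ⟨α₁, α₂, β, γ, δ, hcon, hre⟩ := SymBidiskAux.forward_of_agler
      (fun z ζ => g (z + ζ, z * ζ)) (fun z ζ => by simp only [add_comm, mul_comm]) v₁ v₂ hA
    refine ⟨WithLp 2 (M × M), inferInstance, inferInstance, inferInstance, α₁, α₂, β, γ, δ,
      hcon, ?_⟩
    rintro _ ⟨⟨z, ζ⟩, ⟨hz, hζ⟩, rfl⟩
    exact hre z ζ hz hζ
  · rintro ⟨H, _, _, _, α₁, α₂, β, γ, δ, hcon, hre⟩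
    exact SymBidiskAux.backward g α₁ α₂ β γ δ hcon hre SymBidiskAux.symBidisk_open
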